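/- arXiv:1611.09909 — 2 statements merged into one kernel-verified Lean document; each statement's English description precedes it below -/
import Mathlib

section
/- Let N be a positive integer, c > 0, and n ≤ N/2. Suppose p₁,…,pₙ ∈ D_Δ are distinct and all nonzero, and satisfy the Bethe equations exp(iNp_j) = (−1)^{n−1} exp(−i Σ_{k=1}^n Θ(p_j,p_k)) for every j ∈ {1,…,n}. Then the Bethe ansatz vector ψ satisfies V ψ = Λ ψ, where Λ = Π_{j=1}^n L(e^{ip_j}) + Π_{j=1}^n M(e^{ip_j}). -/
open scoped BigOperators
open Complex

noncomputable section

/-- `S(x,y) = e^{-ix} + e^{iy} - 2*Delta`. -/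
def Sfun (Δ x y : ℝ) : ℂ :=
  Complex.exp (-(Complex.I * (x : ℂ))) + Complex.exp (Complex.I * (y : ℂ)) - 2 * (Δ : ℂ)

/-- `μ`, the unique solution of `cos μ = -Δ` in `[0, π)` when `Δ ∈ [-1, 1)`, and `0` when `Δ < -1`. -/
def muD (Δ : ℝ) : ℝ := if -1 ≤ Δ then Real.arccos (-Δ) else 0

/-- `D_Δ = (-π + μ, π - μ)`. -/
def Ddom (Δ : ℝ) : Set ℝ := Set.Ioo (-Real.pi + muD Δ) (Real.pi - muD Δ)

/-- `L(z) = 1 + c²z/(1-z)`. -/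
def Lfun (c : ℝ) (z : ℂ) : ℂ := 1 + (c : ℂ) ^ 2 * z / (1 - z)

/-- `M(z) = 1 - c²/(1-z)`. -/
def Mfun (c : ℝ) (z : ℂ) : ℂ := 1 - (c : ℂ) ^ 2 / (1 - z)

/-- `z_j = e^{i p_j}`. -/
def zOf {n : ℕ} (p : Fin n → ℝ) : Fin n → ℂ := fun j => Complex.exp (Complex.I * (p j : ℂ))

/-- The coefficient `A_σ`. -/
def Acoef {n : ℕ} (Δ : ℝ) (p : Fin n → ℝ) (σ : Equiv.Perm (Fin n)) : ℂ :=
  ((Equiv.Perm.sign σ : ℤ) : ℂ) *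
    ∏ kl ∈ Finset.univ.filter (fun kl : Fin n × Fin n => kl.1 < kl.2),
      Complex.exp (Complex.I * (p (σ kl.1) : ℂ)) * Sfun Δ (p (σ kl.1)) (p (σ kl.2))

/-- Positions (in `{1, …, N}`) of a subset of `Fin N`, in increasing order. -/
def posList {N : ℕ} (A : Finset (Fin N)) : List ℕ :=
  (A.sort (· ≤ ·)).map (fun i => (i : ℕ) + 1)

/-- `a₁ ≤ b₁ ≤ a₂ ≤ b₂ ≤ … ≤ aₙ ≤ bₙ` for two lists of the same length. -/
def seqInterlace (a b : List ℕ) : Prop :=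
  ∀ i, i < a.length →
    (a.getD i 0 ≤ b.getD i 0 ∧ (i + 1 < a.length → b.getD i 0 ≤ a.getD (i + 1) 0))

/-- Interlacement of two subsets of `{1, …, N}`. -/
def Interlaced {N : ℕ} (A B : Finset (Fin N)) : Prop :=
  A.card = B.card ∧
    (seqInterlace (posList A) (posList B) ∨ seqInterlace (posList B) (posList A))

/-- `P(Ψ_x, Ψ_y)`, the number of positions at which `Ψ_x` and `Ψ_y` differ. -/
def Pdiff {N : ℕ} (A B : Finset (Fin N)) : ℕ := (symmDiff A B).card

open scoped Classical in
/-- The transfer matrix `V` of the six-vertex model (case `a = b = 1`). -/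
def transferV (N : ℕ) (c : ℝ) : Matrix (Finset (Fin N)) (Finset (Fin N)) ℂ :=
  Matrix.of fun A B =>
    if A = B then 2 else if Interlaced A B then (c : ℂ) ^ (Pdiff A B) else 0

/-- The Bethe ansatz vector `ψ`. -/
def psiVec (N n : ℕ) (Δ : ℝ) (p : Fin n → ℝ) : Finset (Fin N) → ℂ := fun A =>
  if h : A.card = n then
    ∑ σ : Equiv.Perm (Fin n), Acoef Δ p σ *
      ∏ k : Fin n, Complex.exp (Complex.I * (p (σ k) : ℂ) *
        ((((A.orderIsoOfFin h k : Fin N) : ℕ) + 1 : ℕ) : ℂ))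
  else 0


open scoped Classical in
/-- Sum over strictly increasing sequences. -/
def Zsum (N m : ℕ) (g : ℕ → ℕ → ℂ) : ℂ :=
  ∑ y : Fin m → Fin N, if StrictMono y then ∏ k : Fin m, g k ((y k : ℕ) + 1) else 0

open scoped Classical in
lemma Zsum_cons (N m : ℕ) (g : ℕ → ℕ → ℂ) :
    Zsum N (m + 1) g = ∑ y0 : Fin N, ∑ y : Fin m → Fin N,
      if StrictMono (Fin.cons y0 y : Fin (m + 1) → Fin N) then
        g 0 ((y0 : ℕ) + 1) * ∏ k : Fin m, g (k + 1) ((y k : ℕ) + 1) else 0 := by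
  unfold Zsum
  rw [← (Fin.consEquiv (fun _ : Fin (m + 1) => Fin N)).sum_comp, Fintype.sum_prod_type]
  refine Finset.sum_congr rfl fun y0 _ => Finset.sum_congr rfl fun y _ => ?_
  simp only [Fin.consEquiv, Equiv.coe_fn_mk]
  rw [Fin.prod_univ_succ]
  simp

lemma strictMono_cons_iff {N m : ℕ} (y0 : Fin N) (y : Fin (m + 1) → Fin N) :
    StrictMono (Fin.cons y0 y : Fin (m + 2) → Fin N) ↔ y0 < y 0 ∧ StrictMono y :=
  strictMono_vecCons

lemma Zsum_zero (N : ℕ) (g : ℕ → ℕ → ℂ) : Zsum N 0 g = 1 := by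
  unfold Zsum
  simp [Subsingleton.strictMono]

lemma Zsum_one (N : ℕ) (g : ℕ → ℕ → ℂ) : Zsum N 1 g = ∑ y : Fin N, g 0 ((y : ℕ) + 1) := by
  rw [Zsum_cons]
  simp [Subsingleton.strictMono]

lemma Zsum_rec (N m : ℕ) (g : ℕ → ℕ → ℂ) (X : ℕ → ℕ)
    (hsupp : ∀ k, k < m + 2 → ∀ y, g k y ≠ 0 → X k ≤ y ∧ y ≤ X (k + 1))
    (h12 : 0 < m → X 1 < X 2) (h1 : 1 ≤ X 1) (h1N : X 1 ≤ N) :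
    Zsum N (m + 2) g = (∑ y : Fin N, g 0 ((y : ℕ) + 1)) * Zsum N (m + 1) (fun k => g (k + 1))
      - g 0 (X 1) * g 1 (X 1) * Zsum N m (fun k => g (k + 2)) := by
  classical
  set v : Fin N := ⟨X 1 - 1, by omega⟩ with hv
  have hv1 : (v : ℕ) + 1 = X 1 := by simp [hv]; omega
  have hiff : ∀ y : Fin N, (y : ℕ) + 1 = X 1 ↔ y = v := by
    intro y; rw [← hv1, Fin.ext_iff]; omega
  have hA : (∑ y : Fin N, g 0 ((y : ℕ) + 1)) * Zsum N (m + 1) (fun k => g (k + 1)) =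
      ∑ y0 : Fin N, ∑ y : Fin (m + 1) → Fin N, if StrictMono y then
        g 0 ((y0 : ℕ) + 1) * ∏ k : Fin (m + 1), g (k + 1) ((y k : ℕ) + 1) else 0 := by
    unfold Zsum
    rw [Finset.sum_mul_sum]
    refine Finset.sum_congr rfl fun y0 _ => Finset.sum_congr rfl fun y _ => ?_
    split_ifs <;> simp
  have hB : g 0 (X 1) * g 1 (X 1) * Zsum N m (fun k => g (k + 2)) =
      ∑ y0 : Fin N, ∑ y : Fin (m + 1) → Fin N, if StrictMono y ∧ y0 = v ∧ y 0 = v then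
        g 0 ((y0 : ℕ) + 1) * ∏ k : Fin (m + 1), g (k + 1) ((y k : ℕ) + 1) else 0 := by
    rw [Finset.sum_eq_single v]
    · rw [← (Fin.consEquiv (fun _ : Fin (m + 1) => Fin N)).sum_comp, Fintype.sum_prod_type,
        Finset.sum_eq_single v]
      · unfold Zsum
        rw [Finset.mul_sum]
        refine Finset.sum_congr rfl fun y _ => ?_
        simp only [Fin.consEquiv, Equiv.coe_fn_mk, Fin.cons_zero, and_true]
        rw [Fin.prod_univ_succ]
        simp only [Fin.cons_zero, Fin.cons_succ, Fin.val_zero, Fin.val_succ, hv1, zero_add]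
        by_cases hz : ∏ k : Fin m, g ((k : ℕ) + 2) ((y k : ℕ) + 1) = 0
        · rw [hz]; simp
        · have : StrictMono (Fin.cons v y : Fin (m + 1) → Fin N) ↔ StrictMono y := by
            cases m with
            | zero =>
              have : Subsingleton (Fin (0 + 1)) := inferInstanceAs (Subsingleton (Fin 1))
              exact ⟨fun _ => Subsingleton.strictMono _, fun _ => Subsingleton.strictMono _⟩
            | succ m =>
              rw [strictMono_cons_iff]
              refine and_iff_right ?_
              have h0 := Finset.prod_ne_zero_iff.1 hz 0 (Finset.mem_univ _)
              have := (hsupp 2 (by omega) _ h0).1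
              have := h12 (by omega)
              rw [Fin.lt_def]; omega
          simp only [this]
          split_ifs
          · rw [mul_assoc]
          · simp
      · intro b _ hb
        refine Finset.sum_eq_zero fun y _ => ?_
        rw [if_neg]
        simp [Fin.consEquiv, hb]
      · simp
    · intro b _ hb
      refine Finset.sum_eq_zero fun y _ => ?_
      rw [if_neg]
      simp [hb]
    · simp
  rw [hA, hB, Zsum_cons, ← Finset.sum_sub_distrib]
  refine Finset.sum_congr rfl fun y0 _ => ?_
  rw [← Finset.sum_sub_distrib]
  refine Finset.sum_congr rfl fun y _ => ?_
  simp only [strictMono_cons_iff]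
  by_cases hz : g 0 ((y0 : ℕ) + 1) * ∏ k : Fin (m + 1), g (k + 1) ((y k : ℕ) + 1) = 0
  · rw [hz]; simp
  · have hz0 := left_ne_zero_of_mul hz
    have hz1 := Finset.prod_ne_zero_iff.1 (right_ne_zero_of_mul hz) 0 (Finset.mem_univ _)
    have i0 := (hsupp 0 (by omega) _ hz0).2
    have i1 := (hsupp 1 (by omega) _ hz1).1
    rw [zero_add] at i0
    by_cases hs : StrictMono y
    · by_cases hlt : y0 < y 0
      · have : ¬ (y0 = v ∧ y 0 = v) := by rintro ⟨h, h'⟩; rw [h, h'] at hlt; exact lt_irrefl _ hlt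
        simp [hs, hlt, this]
      · have h1 : y0 = v := by rw [← hiff]; rw [Fin.lt_def] at hlt; omega
        have h2 : y 0 = v := by rw [← hiff]; rw [Fin.lt_def] at hlt; omega
        rw [if_neg (by tauto), if_pos hs, if_pos ⟨hs, h1, h2⟩, sub_self]
    · simp [hs]

/-- Pure algebra: unfolding the two-step recursion. -/
lemma rec_K (n : ℕ) (a b d F : ℕ → ℂ) (hFn : F n = 1) (hFn1 : F (n + 1) = 0)
    (hF : ∀ i, i < n → F i = (a i + b i) * F (i + 1) - d i * F (i + 2)) (i : ℕ) (hi : i < n) :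
    F i - a i * F (i + 1) = ∏ k ∈ Finset.Ico i n, b k +
      ∑ m ∈ Finset.Ico i (n - 1), (∏ k ∈ Finset.Ico i m, b k) *
        (b m * a (m + 1) - d m) * F (m + 2) := by
  obtain ⟨t, rfl⟩ : ∃ t, n = i + t + 1 := ⟨n - i - 1, by omega⟩
  induction t generalizing i with
  | zero =>
    have := hF i (by omega)
    simp only [add_zero] at *
    rw [this, hFn, show i + 2 = i + 1 + 1 from rfl, hFn1]; simp
  | succ t ih =>
    have e : i + (t + 1) + 1 = (i + 1) + t + 1 := by omega
    have h2 := ih (i + 1) (by rw [← e]; exact hFn) (by rw [← e]; exact hFn1)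
      (by rw [← e]; exact hF) (by omega)
    rw [← e] at h2
    have h1 := hF i (by omega)
    rw [Finset.prod_eq_prod_Ico_succ_bot (by omega : i < i + (t + 1) + 1),
      Finset.sum_eq_sum_Ico_succ_bot (by omega : i < i + (t + 1) + 1 - 1)]
    have h3 : ∑ m ∈ Finset.Ico (i + 1) (i + (t + 1) + 1 - 1), (∏ k ∈ Finset.Ico i m, b k) *
        (b m * a (m + 1) - d m) * F (m + 2) = b i *
        ∑ m ∈ Finset.Ico (i + 1) (i + (t + 1) + 1 - 1), (∏ k ∈ Finset.Ico (i + 1) m, b k) *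
        (b m * a (m + 1) - d m) * F (m + 2) := by
      rw [Finset.mul_sum]
      refine Finset.sum_congr rfl fun m hm => ?_
      rw [Finset.prod_eq_prod_Ico_succ_bot (by have := Finset.mem_Ico.1 hm; omega : i < m)]
      ring
    rw [h3]
    simp only [Finset.Ico_self, Finset.prod_empty, one_mul]
    linear_combination h1 + b i * h2

lemma rec_F (n : ℕ) (a b d F : ℕ → ℂ) (hFn : F n = 1) (hFn1 : F (n + 1) = 0)
    (hF : ∀ i, i < n → F i = (a i + b i) * F (i + 1) - d i * F (i + 2)) :
    F 0 = ∑ j ∈ Finset.range (n + 1),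
        (∏ k ∈ Finset.range j, a k) * ∏ k ∈ Finset.Ico j n, b k +
      ∑ j ∈ Finset.range n, ∑ m ∈ Finset.Ico j (n - 1),
        (∏ k ∈ Finset.range j, a k) * ((∏ k ∈ Finset.Ico j m, b k) *
        (b m * a (m + 1) - d m) * F (m + 2)) := by
  have key : ∀ t, t ≤ n → F 0 = (∏ k ∈ Finset.range t, a k) * F t +
      ∑ j ∈ Finset.range t, (∏ k ∈ Finset.range j, a k) * (F j - a j * F (j + 1)) := by
    intro t
    induction t with
    | zero => simp
    | succ t ih =>
      intro ht
      rw [ih (by omega), Finset.prod_range_succ, Finset.sum_range_succ]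
      ring
  rw [key n le_rfl, hFn, Finset.sum_range_succ, Finset.Ico_self, Finset.prod_empty,
    add_comm (∑ x ∈ Finset.range n, _) _, add_assoc, ← Finset.sum_add_distrib]
  congr 1
  refine Finset.sum_congr rfl fun j hj => ?_
  rw [rec_K n a b d F hFn hFn1 hF j (Finset.mem_range.1 hj), mul_add, Finset.mul_sum]

/-- One-particle weights. -/
def wgt (c : ℝ) (X : ℕ → ℕ) (k y : ℕ) : ℂ :=
  if X k ≤ y ∧ y ≤ X (k + 1) then (if y = X k ∨ y = X (k + 1) then 1 else (c : ℂ) ^ 2) else 0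

/-- The permuted sequence of `z`'s, extended to all naturals. -/
def zext {n : ℕ} (z : Fin n → ℂ) (σ : Equiv.Perm (Fin n)) (k : ℕ) : ℂ :=
  if h : k < n then z (σ ⟨k, h⟩) else 0

def gf {n : ℕ} (c : ℝ) (X : ℕ → ℕ) (z : Fin n → ℂ) (σ : Equiv.Perm (Fin n)) (k y : ℕ) : ℂ :=
  wgt c X k y * zext z σ k ^ y

def alp (N v : ℕ) : ℂ := if 1 ≤ v ∧ v ≤ N then 1 else 0

def af {n : ℕ} (c : ℝ) (N : ℕ) (X : ℕ → ℕ) (z : Fin n → ℂ) (σ : Equiv.Perm (Fin n)) (k : ℕ) : ℂ :=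
  (Lfun c (zext z σ k) - 1 + alp N (X k)) * zext z σ k ^ X k

def bf {n : ℕ} (c : ℝ) (N : ℕ) (X : ℕ → ℕ) (z : Fin n → ℂ) (σ : Equiv.Perm (Fin n)) (k : ℕ) : ℂ :=
  (Mfun c (zext z σ k) - 1 + alp N (X (k + 1))) * zext z σ k ^ X (k + 1)

lemma sum_wgt (c : ℝ) (N : ℕ) (X : ℕ → ℕ) (k : ℕ) (ζ : ℂ) (hζ : ζ ≠ 1)
    (h : X k < X (k + 1)) (hN : X (k + 1) ≤ N + 1) :
    ∑ y : Fin N, wgt c X k ((y : ℕ) + 1) * ζ ^ ((y : ℕ) + 1) =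
      (Lfun c ζ - 1 + alp N (X k)) * ζ ^ X k +
      (Mfun c ζ - 1 + alp N (X (k + 1))) * ζ ^ X (k + 1) := by
  set u := X k
  set v := X (k + 1)
  rw [Fin.sum_univ_eq_sum_range (fun y => wgt c X k (y + 1) * ζ ^ (y + 1)) N,
    Finset.range_eq_Ico, Finset.sum_Ico_add' (fun y => wgt c X k y * ζ ^ y) 0 N 1]
  have hf : ∀ y, wgt c X k y * ζ ^ y = (if y = u then ζ ^ u else 0) + (if y = v then ζ ^ v else 0)
      + (if y ∈ Finset.Ico (u + 1) v then (c : ℂ) ^ 2 * ζ ^ y else 0) := by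
    intro y
    unfold wgt
    change (if u ≤ y ∧ y ≤ v then (if y = u ∨ y = v then 1 else (c : ℂ) ^ 2) else 0) * ζ ^ y = _
    by_cases h1 : y = u
    · subst h1
      rw [if_pos (by omega), if_pos (by omega), if_pos rfl, if_neg (by omega),
        if_neg (by rw [Finset.mem_Ico]; omega)]
      ring
    by_cases h2 : y = v
    · subst h2
      rw [if_pos (by omega), if_pos (by omega), if_neg h1, if_pos rfl,
        if_neg (by rw [Finset.mem_Ico]; omega)]
      ring
    rw [if_neg h1, if_neg h2, if_neg (show ¬ (y = u ∨ y = v) by tauto)]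
    by_cases h3 : u ≤ y ∧ y ≤ v
    · rw [if_pos h3, if_pos (by rw [Finset.mem_Ico]; omega)]; ring
    · rw [if_neg h3, if_neg (by rw [Finset.mem_Ico]; omega)]; ring
  have halp : ∀ w, (∑ y ∈ Finset.Ico (0 + 1) (N + 1), if y = w then ζ ^ w else 0)
      = alp N w * ζ ^ w := by
    intro w
    rw [Finset.sum_ite_eq' (Finset.Ico (0 + 1) (N + 1)) w (fun _ => ζ ^ w)]
    unfold alp
    simp only [Finset.mem_Ico, zero_add, Nat.lt_succ_iff]
    split_ifs <;> simp
  have h1ζ : (1 : ℂ) - ζ ≠ 0 := sub_ne_zero.2 (Ne.symm hζ)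
  have h2ζ : ζ - 1 ≠ 0 := sub_ne_zero.2 hζ
  simp only [hf]
  rw [Finset.sum_add_distrib, Finset.sum_add_distrib, halp, halp, Finset.sum_ite_mem,
    Finset.inter_eq_right.2 (Finset.Ico_subset_Ico (by omega) hN), ← Finset.mul_sum,
    geom_sum_Ico hζ (by omega : u + 1 ≤ v)]
  unfold Lfun Mfun
  field_simp
  ring

/-- the two-body factor -/
def hfac {n : ℕ} (Δ : ℝ) (z : Fin n → ℂ) (u v : Fin n) : ℂ := 1 + z u * z v - 2 * (Δ : ℂ) * z u

def Ac {n : ℕ} (Δ : ℝ) (z : Fin n → ℂ) (σ : Equiv.Perm (Fin n)) : ℂ :=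
  ((Equiv.Perm.sign σ : ℤ) : ℂ) *
    ∏ kl ∈ Finset.univ.filter (fun kl : Fin n × Fin n => kl.1 < kl.2),
      hfac Δ z (σ kl.1) (σ kl.2)

lemma Ac_swap {n : ℕ} (Δ : ℝ) (z : Fin n → ℂ) (σ : Equiv.Perm (Fin n)) (m : ℕ) (hm : m + 1 < n) :
    Ac Δ z (σ * Equiv.swap ⟨m, by omega⟩ ⟨m + 1, hm⟩) *
      hfac Δ z (σ ⟨m, by omega⟩) (σ ⟨m + 1, hm⟩) =
    - (Ac Δ z σ * hfac Δ z (σ ⟨m + 1, hm⟩) (σ ⟨m, by omega⟩)) := by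
  set i : Fin n := ⟨m, by omega⟩ with hi
  set j : Fin n := ⟨m + 1, hm⟩ with hj
  have hij : i ≠ j := by rw [hi, hj]; simp [Fin.ext_iff]
  have hij' : i < j := by rw [hi, hj]; simp [Fin.lt_def]
  set τ := Equiv.swap i j with hτ
  have hmem : (i, j) ∈ Finset.univ.filter (fun kl : Fin n × Fin n => kl.1 < kl.2) := by
    simp [hij']
  unfold Ac
  rw [← Finset.mul_prod_erase _ _ hmem, ← Finset.mul_prod_erase _ _ hmem]
  have hmon : ∀ k l : Fin n, k < l → (k, l) ≠ (i, j) → τ k < τ l ∧ (τ k, τ l) ≠ (i, j) := by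
    intro k l hkl hne
    have hne' : ¬ (k = i ∧ l = j) := by simpa using hne
    have e : ∀ a : Fin n, (a = i ∧ τ a = j) ∨ (a = j ∧ τ a = i) ∨ (a ≠ i ∧ a ≠ j ∧ τ a = a) := by
      intro a
      by_cases h1 : a = i
      · left; exact ⟨h1, by rw [h1, hτ, Equiv.swap_apply_left]⟩
      by_cases h2 : a = j
      · right; left; exact ⟨h2, by rw [h2, hτ, Equiv.swap_apply_right]⟩
      · right; right; exact ⟨h1, h2, Equiv.swap_apply_of_ne_of_ne h1 h2⟩
    have iv : (i : ℕ) = m := rfl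
    have jv : (j : ℕ) = m + 1 := rfl
    rw [Ne, Prod.mk.injEq]
    simp only [Fin.ext_iff, Fin.lt_def, Ne] at *
    rcases e k with ⟨h1, h2⟩ | ⟨h1, h2⟩ | ⟨h1, h2, h3⟩ <;>
      rcases e l with ⟨h4, h5⟩ | ⟨h4, h5⟩ | ⟨h4, h5, h6⟩ <;> omega
  have hττ : ∀ a, τ (τ a) = a := fun a => Equiv.swap_apply_self _ _ a
  have hprod : ∏ x ∈ (Finset.univ.filter (fun kl : Fin n × Fin n => kl.1 < kl.2)).erase (i, j),
        hfac Δ z ((σ * τ) x.1) ((σ * τ) x.2) =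
      ∏ x ∈ (Finset.univ.filter (fun kl : Fin n × Fin n => kl.1 < kl.2)).erase (i, j),
        hfac Δ z (σ x.1) (σ x.2) := by
    refine Finset.prod_nbij' (fun x => (τ x.1, τ x.2)) (fun x => (τ x.1, τ x.2)) ?_ ?_ ?_ ?_ ?_
    · rintro ⟨k, l⟩ hx
      simp only [Finset.mem_erase, Finset.mem_filter, Finset.mem_univ, true_and] at hx ⊢
      have := hmon k l hx.2 hx.1
      exact ⟨this.2, this.1⟩
    · rintro ⟨k, l⟩ hx
      simp only [Finset.mem_erase, Finset.mem_filter, Finset.mem_univ, true_and] at hx ⊢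
      have := hmon k l hx.2 hx.1
      exact ⟨this.2, this.1⟩
    · rintro ⟨k, l⟩ _; simp [hττ]
    · rintro ⟨k, l⟩ _; simp [hττ]
    · rintro ⟨k, l⟩ _; rfl
  rw [hprod]
  have hs : ((Equiv.Perm.sign (σ * τ) : ℤ) : ℂ) = - ((Equiv.Perm.sign σ : ℤ) : ℂ) := by
    rw [Equiv.Perm.sign_mul, hτ, Equiv.Perm.sign_swap hij]; simp
  rw [hs]
  have e1 : (σ * τ) i = σ j := by simp [hτ]
  have e2 : (σ * τ) j = σ i := by simp [hτ]
  simp only [e1, e2]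
  ring

lemma zext_swap {n : ℕ} (z : Fin n → ℂ) (σ : Equiv.Perm (Fin n)) (m : ℕ) (hm : m + 1 < n)
    (k : ℕ) (h1 : k ≠ m) (h2 : k ≠ m + 1) :
    zext z (σ * Equiv.swap ⟨m, by omega⟩ ⟨m + 1, hm⟩) k = zext z σ k := by
  unfold zext
  split_ifs with h
  · rw [Equiv.Perm.mul_apply, Equiv.swap_apply_of_ne_of_ne] <;> simp [Fin.ext_iff, h1, h2]
  · rfl

/-- Main cancellation (two-body) lemma. -/
lemma sum_Ac_Zsum (N n : ℕ) (c Δ : ℝ) (hΔ : Δ = (2 - c ^ 2) / 2) (z : Fin n → ℂ)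
    (hz : ∀ j, z j ≠ 1) (X : ℕ → ℕ) (hX : ∀ k, k < n → X k < X (k + 1))
    (hX1 : ∀ k, 0 < k → k < n → 1 ≤ X k) (hXN : ∀ k, 0 < k → k < n → X k ≤ N)
    (hXn : ∀ k, k ≤ n → X k ≤ N + 1) :
    ∑ σ : Equiv.Perm (Fin n), Ac Δ z σ * Zsum N n (gf c X z σ) =
    ∑ σ : Equiv.Perm (Fin n), Ac Δ z σ * ∑ j ∈ Finset.range (n + 1),
        (∏ k ∈ Finset.range j, af c N X z σ k) * ∏ k ∈ Finset.Ico j n, bf c N X z σ k := by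
  have hze : ∀ σ k, k < n → zext z σ k ≠ 1 := by
    intro σ k hk; unfold zext; rw [dif_pos hk]; exact hz _
  set F : Equiv.Perm (Fin n) → ℕ → ℂ := fun σ i =>
    if i ≤ n then Zsum N (n - i) (fun k => gf c X z σ (k + i)) else 0 with hFdef
  set d : Equiv.Perm (Fin n) → ℕ → ℂ := fun σ i =>
    zext z σ i ^ X (i + 1) * zext z σ (i + 1) ^ X (i + 1) with hd
  have hwd : ∀ k, k < n → wgt c X k (X (k + 1)) = 1 := by
    intro k hk; unfold wgt; rw [if_pos ⟨(hX k hk).le, le_rfl⟩, if_pos (Or.inr rfl)]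
  have hwd' : ∀ k, k < n → wgt c X k (X k) = 1 := by
    intro k hk; unfold wgt; rw [if_pos ⟨le_rfl, (hX k hk).le⟩, if_pos (Or.inl rfl)]
  have hrec : ∀ σ i, i < n → F σ i = (af c N X z σ i + bf c N X z σ i) * F σ (i + 1)
      - d σ i * F σ (i + 2) := by
    intro σ i hi
    have hsum : ∑ y : Fin N, gf c X z σ i ((y : ℕ) + 1) = af c N X z σ i + bf c N X z σ i :=
      sum_wgt c N X i _ (hze σ i hi) (hX i hi) (hXn _ hi)
    by_cases hi1 : i + 1 = n
    · simp only [hFdef]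
      rw [if_pos (by omega), if_pos (by omega), if_neg (by omega), show n - i = 1 by omega,
        show n - (i + 1) = 0 by omega, Zsum_one, Zsum_zero, ← hsum]
      simp
    · obtain ⟨t, ht⟩ : ∃ t, n = i + t + 2 := ⟨n - i - 2, by omega⟩
      simp only [hFdef]
      rw [if_pos (by omega), if_pos (by omega), if_pos (by omega), show n - i = t + 2 by omega,
        show n - (i + 1) = t + 1 by omega, show n - (i + 2) = t by omega]
      have := Zsum_rec N t (fun k => gf c X z σ (k + i)) (fun k => X (k + i)) ?_ ?_ ?_ ?_
      · rw [this]
        simp only [zero_add]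
        rw [hsum]
        have e1 : (fun k => gf c X z σ (k + 1 + i)) = fun k => gf c X z σ (k + (i + 1)) := by
          funext k; congr 1; omega
        have e2 : (fun k => gf c X z σ (k + 2 + i)) = fun k => gf c X z σ (k + (i + 2)) := by
          funext k; congr 1; omega
        rw [e1, e2, add_comm 1 i]
        congr 2
        simp only [hd, gf]
        rw [hwd i hi, hwd' (i + 1) (by omega)]
        ring
      · intro k hk y hy
        have h1 : wgt c X (k + i) y ≠ 0 := left_ne_zero_of_mul hy
        unfold wgt at h1
        have := (ite_ne_right_iff.1 h1).1
        rw [show k + 1 + i = k + i + 1 by omega]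
        exact this
      · intro ht0
        rw [add_comm 1 i, show 2 + i = i + 1 + 1 by omega]
        exact hX _ (by omega)
      · exact hX1 _ (by omega) (by omega)
      · exact hXN _ (by omega) (by omega)
  have hF0 : ∀ σ, Zsum N n (gf c X z σ) = F σ 0 := by
    intro σ; simp [hFdef]
  have hFn : ∀ σ, F σ n = 1 := by
    intro σ; simp [hFdef, Zsum_zero]
  have hFn1 : ∀ σ, F σ (n + 1) = 0 := by
    intro σ; simp [hFdef]
  have hexp := fun σ => rec_F n (af c N X z σ) (bf c N X z σ) (d σ) (F σ) (hFn σ) (hFn1 σ) (hrec σ)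
  simp only [hF0]
  have : ∀ σ, Ac Δ z σ * F σ 0 = Ac Δ z σ * ∑ j ∈ Finset.range (n + 1),
        (∏ k ∈ Finset.range j, af c N X z σ k) * ∏ k ∈ Finset.Ico j n, bf c N X z σ k +
      ∑ j ∈ Finset.range n, ∑ m ∈ Finset.Ico j (n - 1),
        Ac Δ z σ * ((∏ k ∈ Finset.range j, af c N X z σ k) *
        ((∏ k ∈ Finset.Ico j m, bf c N X z σ k) *
        (bf c N X z σ m * af c N X z σ (m + 1) - d σ m) * F σ (m + 2))) := by
    intro σ
    rw [hexp σ, mul_add, Finset.mul_sum (Finset.range n)]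
    congr 1
    refine Finset.sum_congr rfl fun j _ => ?_
    rw [Finset.mul_sum]
  simp only [this]
  rw [Finset.sum_add_distrib, add_eq_left, Finset.sum_comm]
  refine Finset.sum_eq_zero fun j hj => ?_
  rw [Finset.sum_comm]
  refine Finset.sum_eq_zero fun m hm => ?_
  have hjm : j ≤ m := (Finset.mem_Ico.1 hm).1
  have hmn : m + 1 < n := by have := (Finset.mem_Ico.1 hm).2; omega
  set τ : Equiv.Perm (Fin n) := Equiv.swap ⟨m, by omega⟩ ⟨m + 1, hmn⟩ with hτ
  rw [← self_eq_neg, ← Finset.sum_neg_distrib]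
  rw [← Equiv.sum_comp (Equiv.mulRight τ)]
  refine Finset.sum_congr rfl fun σ _ => ?_
  simp only [Equiv.coe_mulRight]
  have za : ∀ k, k ≠ m → k ≠ m + 1 → zext z (σ * τ) k = zext z σ k :=
    fun k h1 h2 => zext_swap z σ m hmn k h1 h2
  have p1 : ∏ k ∈ Finset.range j, af c N X z (σ * τ) k = ∏ k ∈ Finset.range j, af c N X z σ k := by
    refine Finset.prod_congr rfl fun k hk => ?_
    have := Finset.mem_range.1 hk
    unfold af
    rw [za k (by omega) (by omega)]
  have p2 : ∏ k ∈ Finset.Ico j m, bf c N X z (σ * τ) k = ∏ k ∈ Finset.Ico j m, bf c N X z σ k := by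
    refine Finset.prod_congr rfl fun k hk => ?_
    have := Finset.mem_Ico.1 hk
    unfold bf
    rw [za k (by omega) (by omega)]
  have p3 : F (σ * τ) (m + 2) = F σ (m + 2) := by
    simp only [hFdef]
    have : (fun k => gf c X z (σ * τ) (k + (m + 2))) = fun k => gf c X z σ (k + (m + 2)) := by
      funext k y
      unfold gf
      rw [za _ (by omega) (by omega)]
    rw [this]
  set i : Fin n := ⟨m, by omega⟩ with hi
  set i' : Fin n := ⟨m + 1, hmn⟩ with hi'
  have ze : ∀ ρ : Equiv.Perm (Fin n),
      bf c N X z ρ m * af c N X z ρ (m + 1) - d ρ m =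
      - (c : ℂ) ^ 2 * hfac Δ z (ρ i') (ρ i) * ((z (ρ i) * z (ρ i')) ^ X (m + 1) /
        ((1 - z (ρ i)) * (1 - z (ρ i')))) := by
    intro ρ
    have z1 : zext z ρ m = z (ρ i) := by unfold zext; rw [dif_pos]
    have z2 : zext z ρ (m + 1) = z (ρ i') := by unfold zext; rw [dif_pos]
    have n1 : 1 - z (ρ i) ≠ 0 := sub_ne_zero.2 (Ne.symm (hz _))
    have n2 : 1 - z (ρ i') ≠ 0 := sub_ne_zero.2 (Ne.symm (hz _))
    simp only [bf, af, hd, z1, z2]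
    have al : alp N (X (m + 1)) = 1 := by
      unfold alp; rw [if_pos ⟨hX1 _ (by omega) hmn, hXN _ (by omega) hmn⟩]
    rw [al]
    unfold Lfun Mfun hfac
    rw [mul_pow, hΔ]
    push_cast
    field_simp
    ring
  rw [p1, p2, p3, ze, ze]
  have e1 : (σ * τ) i = σ i' := by simp [hτ]
  have e2 : (σ * τ) i' = σ i := by simp [hτ]
  rw [e1, e2]
  have hsw := Ac_swap Δ z σ m hmn
  rw [mul_comm (z (σ i')) (z (σ i)), mul_comm (1 - z (σ i')) (1 - z (σ i))]
  linear_combination (∏ k ∈ Finset.range j, af c N X z σ k) *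
        ((∏ k ∈ Finset.Ico j m, bf c N X z σ k) * (- (c : ℂ) ^ 2 *
        ((z (σ i) * z (σ i')) ^ X (m + 1) /
        ((1 - z (σ i)) * (1 - z (σ i'))))) * F σ (m + 2)) * hsw

lemma prod_filter_lt {n : ℕ} (f : Fin n → Fin n → ℂ) :
    ∏ kl ∈ Finset.univ.filter (fun kl : Fin n × Fin n => kl.1 < kl.2), f kl.1 kl.2 =
      ∏ k : Fin n, ∏ l : Fin n, if k < l then f k l else 1 := by
  rw [Finset.prod_filter, Fintype.prod_prod_type]

lemma rot_zero {m : ℕ} (σ : Equiv.Perm (Fin (m + 1))) :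
    (σ * (finRotate (m + 1))⁻¹) 0 = σ (Fin.last m) := by
  rw [Equiv.Perm.mul_apply]
  exact congrArg σ (Equiv.Perm.inv_eq_iff_eq.2 finRotate_last.symm)

lemma rot_succ {m : ℕ} (σ : Equiv.Perm (Fin (m + 1))) (k : Fin m) :
    (σ * (finRotate (m + 1))⁻¹) k.succ = σ k.castSucc := by
  rw [Equiv.Perm.mul_apply]
  congr 1
  rw [Equiv.Perm.inv_eq_iff_eq, finRotate_apply]
  simp

lemma Ac_rot {m : ℕ} (Δ : ℝ) (z : Fin (m + 1) → ℂ) (N : ℕ)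
    (hne : ∀ j k, hfac Δ z j k ≠ 0)
    (hBE : ∀ j, z j ^ N = (-1) ^ m * ∏ k, (hfac Δ z j k / hfac Δ z k j))
    (σ : Equiv.Perm (Fin (m + 1))) :
    Ac Δ z (σ * (finRotate (m + 1))⁻¹) = Ac Δ z σ * z (σ (Fin.last m)) ^ N := by
  have hs : ((Equiv.Perm.sign (σ * (finRotate (m + 1))⁻¹) : ℤ) : ℂ) =
      ((Equiv.Perm.sign σ : ℤ) : ℂ) * (-1) ^ m := by
    rw [Equiv.Perm.sign_mul, Equiv.Perm.sign_inv, sign_finRotate]; simp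
  unfold Ac
  rw [hs, hBE, ← Equiv.prod_comp σ,
    prod_filter_lt (fun k l => hfac Δ z ((σ * (finRotate (m + 1))⁻¹) k)
      ((σ * (finRotate (m + 1))⁻¹) l)),
    prod_filter_lt (fun k l => hfac Δ z (σ k) (σ l))]
  have h0 : ∏ i : Fin m, hfac Δ z (σ i.castSucc) (σ (Fin.last m)) ≠ 0 :=
    Finset.prod_ne_zero_iff.2 fun _ _ => hne _ _
  have h1 : ∏ x : Fin m, (if Fin.last m < x.castSucc then
      hfac Δ z (σ (Fin.last m)) (σ x.castSucc) else 1) = 1 := by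
    refine Finset.prod_eq_one fun x _ => ?_
    rw [if_neg (not_lt.2 (Fin.le_last _))]
  have pL : (∏ k, ∏ l, if k < l then hfac Δ z ((σ * (finRotate (m + 1))⁻¹) k)
      ((σ * (finRotate (m + 1))⁻¹) l) else 1) =
      (∏ l : Fin m, hfac Δ z (σ (Fin.last m)) (σ l.castSucc)) *
      ∏ k : Fin m, ∏ l : Fin m, if k < l then hfac Δ z (σ k.castSucc) (σ l.castSucc) else 1 := by
    simp only [Fin.prod_univ_succ (n := m), rot_zero, rot_succ, lt_self_iff_false, if_false,
      Fin.succ_pos, if_true, Fin.not_lt_zero, Fin.succ_lt_succ_iff, one_mul]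
  have pR : (∏ k, ∏ l, if k < l then hfac Δ z (σ k) (σ l) else 1) =
      (∏ l : Fin m, hfac Δ z (σ l.castSucc) (σ (Fin.last m))) *
      ∏ k : Fin m, ∏ l : Fin m, if k < l then hfac Δ z (σ k.castSucc) (σ l.castSucc) else 1 := by
    simp only [Fin.prod_univ_castSucc (n := m), lt_self_iff_false, if_false,
      Fin.castSucc_lt_last, if_true, Fin.castSucc_lt_castSucc_iff, mul_one,
      Finset.prod_mul_distrib, h1]
    ring
  rw [pL, pR, Fin.prod_univ_castSucc, div_self (hne _ _), Finset.prod_div_distrib]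
  field_simp

/-- Cancellation of boundary terms. -/
lemma boundary_cancel {m : ℕ} (c Δ : ℝ) (z : Fin (m + 1) → ℂ) (N : ℕ)
    (hne : ∀ j k, hfac Δ z j k ≠ 0)
    (hBE : ∀ j, z j ^ N = (-1) ^ m * ∏ k, (hfac Δ z j k / hfac Δ z k j))
    (X : ℕ → ℕ) (hX0 : X 0 = 0) (hXl : X (m + 2) = N + 1) (j : ℕ) (hj : j < m + 1) :
    ∑ σ : Equiv.Perm (Fin (m + 1)), Ac Δ z σ *
        ((∏ k ∈ Finset.range j, af c N (fun k => X (k + 1)) z σ k) *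
          ∏ k ∈ Finset.Ico j (m + 1), bf c N (fun k => X (k + 1)) z σ k) +
    ∑ σ : Equiv.Perm (Fin (m + 1)), Ac Δ z σ *
        ((∏ k ∈ Finset.range (j + 1), af c N X z σ k) *
          ∏ k ∈ Finset.Ico (j + 1) (m + 1), bf c N X z σ k) = 0 := by
  rw [← Equiv.sum_comp (Equiv.mulRight (finRotate (m + 1))⁻¹) (fun σ => Ac Δ z σ *
        ((∏ k ∈ Finset.range (j + 1), af c N X z σ k) *
          ∏ k ∈ Finset.Ico (j + 1) (m + 1), bf c N X z σ k)), ← Finset.sum_add_distrib]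
  refine Finset.sum_eq_zero fun σ _ => ?_
  simp only [Equiv.coe_mulRight]
  have z0 : zext z (σ * (finRotate (m + 1))⁻¹) 0 = z (σ (Fin.last m)) := by
    unfold zext
    rw [dif_pos (by omega), ← rot_zero σ]; rfl
  have zm : zext z σ m = z (σ (Fin.last m)) := by
    unfold zext
    rw [dif_pos (by omega)]; rfl
  have zs : ∀ k, k < m → zext z (σ * (finRotate (m + 1))⁻¹) (k + 1) = zext z σ k := by
    intro k hk
    unfold zext
    rw [dif_pos (by omega), dif_pos (by omega)]
    exact congrArg z (rot_succ σ ⟨k, hk⟩)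
  rw [Finset.prod_range_succ', ← Finset.prod_Ico_add' _ j m 1, Finset.prod_Ico_succ_top (by omega)]
  have p1 : ∏ k ∈ Finset.range j, af c N X z (σ * (finRotate (m + 1))⁻¹) (k + 1) =
      ∏ k ∈ Finset.range j, af c N (fun k => X (k + 1)) z σ k := by
    refine Finset.prod_congr rfl fun k hk => ?_
    have := Finset.mem_range.1 hk
    unfold af
    rw [zs k (by omega)]
  have p2 : ∏ k ∈ Finset.Ico j m, bf c N X z (σ * (finRotate (m + 1))⁻¹) (k + 1) =
      ∏ k ∈ Finset.Ico j m, bf c N (fun k => X (k + 1)) z σ k := by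
    refine Finset.prod_congr rfl fun k hk => ?_
    have := Finset.mem_Ico.1 hk
    unfold bf
    rw [zs k (by omega)]
  rw [p1, p2, Ac_rot Δ z N hne hBE]
  have e1 : af c N X z (σ * (finRotate (m + 1))⁻¹) 0 =
      (c : ℂ) ^ 2 * z (σ (Fin.last m)) / (1 - z (σ (Fin.last m))) := by
    simp [af, z0, hX0, alp, Lfun]
  have e2 : bf c N (fun k => X (k + 1)) z σ m =
      - ((c : ℂ) ^ 2 / (1 - z (σ (Fin.last m)))) * z (σ (Fin.last m)) ^ (N + 1) := by
    simp [bf, zm, hXl, alp, Mfun]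
  rw [e1, e2, pow_succ]
  ring

/-- The algebraic core. -/
lemma core (N n : ℕ) (c Δ : ℝ) (hΔ : Δ = (2 - c ^ 2) / 2) (z : Fin n → ℂ)
    (hz : ∀ j, z j ≠ 1) (hne : ∀ j k, hfac Δ z j k ≠ 0)
    (hBE : ∀ j, z j ^ N = (-1) ^ (n - 1) * ∏ k, (hfac Δ z j k / hfac Δ z k j))
    (X : ℕ → ℕ) (hX0 : X 0 = 0) (hXl : X (n + 1) = N + 1)
    (hX : ∀ k, k ≤ n → X k < X (k + 1))
    (hX1 : ∀ k, 0 < k → k ≤ n → 1 ≤ X k) (hXN : ∀ k, 0 < k → k ≤ n → X k ≤ N) :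
    ∑ σ : Equiv.Perm (Fin n), Ac Δ z σ * Zsum N n (gf c (fun k => X (k + 1)) z σ) +
    ∑ σ : Equiv.Perm (Fin n), Ac Δ z σ * Zsum N n (gf c X z σ) =
    ((∏ j, Lfun c (z j)) + ∏ j, Mfun c (z j)) *
      ∑ σ : Equiv.Perm (Fin n), Ac Δ z σ * ∏ k : Fin n, z (σ k) ^ X (k + 1) := by
  rw [sum_Ac_Zsum N n c Δ hΔ z hz (fun k => X (k + 1)) (fun k hk => hX _ (by omega))
      (fun k _ hk => hX1 _ (by omega) (by omega)) (fun k _ hk => hXN _ (by omega) (by omega))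
      (fun k hk => by
        rcases Nat.lt_or_ge k n with h | h
        · exact (hXN (k + 1) (by omega) (by omega)).trans (by omega)
        · obtain rfl : k = n := le_antisymm hk h
          exact hXl.le),
    sum_Ac_Zsum N n c Δ hΔ z hz X (fun k hk => hX _ (by omega))
      (fun k _ hk => hX1 _ (by omega) (by omega)) (fun k _ hk => hXN _ (by omega) (by omega))
      (fun k hk => by
        rcases Nat.eq_zero_or_pos k with h | h
        · rw [h, hX0]; omega
        · exact (hXN k h hk).trans (by omega))]
  have al : ∀ k, 0 < k → k ≤ n → alp N (X k) = 1 := by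
    intro k h1 h2
    unfold alp; rw [if_pos ⟨hX1 k h1 h2, hXN k h1 h2⟩]
  have hL : ∀ σ : Equiv.Perm (Fin n), ∏ k ∈ Finset.range n, af c N (fun k => X (k + 1)) z σ k =
      (∏ j, Lfun c (z j)) * ∏ k : Fin n, z (σ k) ^ X (k + 1) := by
    intro σ
    rw [← Fin.prod_univ_eq_prod_range, ← Equiv.prod_comp σ (fun j => Lfun c (z j)),
      ← Finset.prod_mul_distrib]
    refine Finset.prod_congr rfl fun k _ => ?_
    have : zext z σ k = z (σ k) := by unfold zext; rw [dif_pos k.2]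
    simp only [af, this]
    rw [al _ (by omega) k.2]; ring
  have hM : ∀ σ : Equiv.Perm (Fin n), ∏ k ∈ Finset.Ico 0 n, bf c N X z σ k =
      (∏ j, Mfun c (z j)) * ∏ k : Fin n, z (σ k) ^ X (k + 1) := by
    intro σ
    rw [← Finset.range_eq_Ico, ← Fin.prod_univ_eq_prod_range,
      ← Equiv.prod_comp σ (fun j => Mfun c (z j)),
      ← Finset.prod_mul_distrib]
    refine Finset.prod_congr rfl fun k _ => ?_
    have : zext z σ k = z (σ k) := by unfold zext; rw [dif_pos k.2]
    simp only [bf, this]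
    rw [al _ (by omega) k.2]; ring
  have hrest : ∑ σ : Equiv.Perm (Fin n), Ac Δ z σ * (∑ j ∈ Finset.range n,
        (∏ k ∈ Finset.range j, af c N (fun k => X (k + 1)) z σ k) *
          ∏ k ∈ Finset.Ico j n, bf c N (fun k => X (k + 1)) z σ k) +
    ∑ σ : Equiv.Perm (Fin n), Ac Δ z σ * (∑ j ∈ Finset.range n,
        (∏ k ∈ Finset.range (j + 1), af c N X z σ k) *
          ∏ k ∈ Finset.Ico (j + 1) n, bf c N X z σ k) = 0 := by
    cases n with
    | zero => simp
    | succ m =>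
      simp only [Finset.mul_sum]
      rw [Finset.sum_comm, Finset.sum_comm (s := Finset.univ) (t := Finset.range (m + 1)),
        ← Finset.sum_add_distrib]
      refine Finset.sum_eq_zero fun j hj => ?_
      exact boundary_cancel c Δ z N hne hBE X hX0 hXl j (Finset.mem_range.1 hj)
  have h1 : ∀ σ : Equiv.Perm (Fin n), Ac Δ z σ * ∑ j ∈ Finset.range (n + 1),
        (∏ k ∈ Finset.range j, af c N (fun k => X (k + 1)) z σ k) *
          ∏ k ∈ Finset.Ico j n, bf c N (fun k => X (k + 1)) z σ k =
      Ac Δ z σ * (∑ j ∈ Finset.range n,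
        (∏ k ∈ Finset.range j, af c N (fun k => X (k + 1)) z σ k) *
          ∏ k ∈ Finset.Ico j n, bf c N (fun k => X (k + 1)) z σ k) +
      (∏ j, Lfun c (z j)) * (Ac Δ z σ * ∏ k : Fin n, z (σ k) ^ X (k + 1)) := by
    intro σ
    rw [Finset.sum_range_succ, Finset.Ico_self, Finset.prod_empty, hL]; ring
  have h2 : ∀ σ : Equiv.Perm (Fin n), Ac Δ z σ * ∑ j ∈ Finset.range (n + 1),
        (∏ k ∈ Finset.range j, af c N X z σ k) * ∏ k ∈ Finset.Ico j n, bf c N X z σ k =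
      Ac Δ z σ * (∑ j ∈ Finset.range n,
        (∏ k ∈ Finset.range (j + 1), af c N X z σ k) *
          ∏ k ∈ Finset.Ico (j + 1) n, bf c N X z σ k) +
      (∏ j, Mfun c (z j)) * (Ac Δ z σ * ∏ k : Fin n, z (σ k) ^ X (k + 1)) := by
    intro σ
    rw [Finset.sum_range_succ', hM, Finset.range_zero, Finset.prod_empty]; ring
  simp only [h1, h2]
  rw [Finset.sum_add_distrib, Finset.sum_add_distrib, ← Finset.mul_sum, ← Finset.mul_sum]
  linear_combination hrest

/-- Extended positions: `0, x₁, …, xₙ, N+1, …`. -/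
def Xf {n N : ℕ} (x : Fin n → Fin N) : ℕ → ℕ
  | 0 => 0
  | (k + 1) => if h : k < n then (x ⟨k, h⟩ : ℕ) + 1 else N + 1

lemma Xf_succ {n N : ℕ} (x : Fin n → Fin N) (k : ℕ) (h : k < n) :
    Xf x (k + 1) = (x ⟨k, h⟩ : ℕ) + 1 := by
  simp only [Xf]; rw [dif_pos h]

lemma Xf_last {n N : ℕ} (x : Fin n → Fin N) : Xf x (n + 1) = N + 1 := by
  simp only [Xf]; rw [dif_neg (lt_irrefl _)]

lemma Xf_lt {n N : ℕ} (x : Fin n → Fin N) (hx : StrictMono x) (a b : ℕ) (hab : a < b)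
    (hb : b ≤ n + 1) : Xf x a < Xf x b := by
  obtain ⟨b, rfl⟩ : ∃ b', b = b' + 1 := ⟨b - 1, by omega⟩
  cases a with
  | zero => simp only [Xf]; split_ifs <;> omega
  | succ a =>
    rw [Xf_succ x a (by omega)]
    by_cases h : b < n
    · rw [Xf_succ x b h]
      have : x ⟨a, by omega⟩ < x ⟨b, h⟩ := hx (by rw [Fin.lt_def]; simp; omega)
      rw [Fin.lt_def] at this
      omega
    · obtain rfl : b = n := by omega
      rw [Xf_last]
      have := (x ⟨a, by omega⟩).2
      omega

lemma Xf_mem {n N : ℕ} (x : Fin n → Fin N) (hx : StrictMono x) (q : ℕ) (hq : q ≤ n) (v : Fin N)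
    (h1 : Xf x q ≤ (v : ℕ) + 1) (h2 : (v : ℕ) + 1 ≤ Xf x (q + 1)) :
    ((v : ℕ) + 1 = Xf x q ∨ (v : ℕ) + 1 = Xf x (q + 1)) ↔ ∃ i, x i = v := by
  constructor
  · rintro (h | h)
    · cases q with
      | zero => simp [Xf] at h
      | succ q =>
        rw [Xf_succ x q (by omega)] at h
        exact ⟨⟨q, by omega⟩, Fin.ext (by omega)⟩
    · by_cases hqn : q < n
      · rw [Xf_succ x q hqn] at h
        exact ⟨⟨q, hqn⟩, Fin.ext (by omega)⟩
      · obtain rfl : q = n := by omega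
        rw [Xf_last] at h
        have := v.2
        omega
  · rintro ⟨i, rfl⟩
    have e : Xf x ((i : ℕ) + 1) = (x i : ℕ) + 1 := Xf_succ x i i.2
    rw [← e] at h1 h2 ⊢
    by_contra hcon
    rcases lt_trichotomy ((i : ℕ) + 1) q with h | h | h
    · have := Xf_lt x hx _ _ h (by omega); omega
    · exact hcon (Or.inl (by rw [h]))
    · rcases Nat.lt_or_ge (q + 1) ((i : ℕ) + 1) with h' | h'
      · have := Xf_lt x hx _ _ h' (by have := i.2; omega); omega
      · exact hcon (Or.inr (by rw [show (i : ℕ) + 1 = q + 1 by omega]))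

lemma posList_eq {N : ℕ} (A : Finset (Fin N)) :
    posList A = A.sort.map (fun i : Fin N => (i : ℕ) + 1) := by
  simp [posList, List.map_eq_flatMap, List.flatMap_assoc]

lemma posList_length {N : ℕ} (A : Finset (Fin N)) : (posList A).length = A.card := by
  simp [posList_eq]

lemma posList_getD {N n : ℕ} (A : Finset (Fin N)) (hA : A.card = n) (i : ℕ) (hi : i < n) :
    (posList A).getD i 0 = (A.orderEmbOfFin hA ⟨i, hi⟩ : ℕ) + 1 := by
  rw [List.getD_eq_getElem _ _ (by rw [posList_length, hA]; exact hi), Finset.orderEmbOfFin_apply]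
  simp only [posList_eq, List.getElem_map]
  rfl

lemma prod_pow_Pdiff {N n : ℕ} (c : ℝ) (A B : Finset (Fin N)) (hA : A.card = n) (hB : B.card = n) :
    ∏ k : Fin n, (if B.orderEmbOfFin hB k ∈ A then (1 : ℂ) else (c : ℂ) ^ 2) =
      (c : ℂ) ^ Pdiff A B := by
  have h1 : ∏ k : Fin n, (if B.orderEmbOfFin hB k ∈ A then (1 : ℂ) else (c : ℂ) ^ 2) =
      ∏ b ∈ B, (if b ∈ A then (1 : ℂ) else (c : ℂ) ^ 2) := by
    conv_rhs => rw [← Finset.map_orderEmbOfFin_univ B hB]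
    rw [Finset.prod_map]
    rfl
  rw [h1, Finset.prod_ite, Finset.prod_const_one, one_mul, Finset.prod_const, ← pow_mul]
  congr 1
  have e1 : B.filter (fun b => b ∉ A) = B \ A := by ext; simp
  have e2 : (A \ B).card = (B \ A).card := Finset.card_sdiff_comm (by rw [hA, hB])
  unfold Pdiff
  rw [e1, symmDiff_def, Finset.sup_eq_union,
    Finset.card_union_of_disjoint disjoint_sdiff_sdiff, e2]
  ring

open scoped Classical in
lemma prod_wgt {N n : ℕ} (c : ℝ) (A B : Finset (Fin N)) (hA : A.card = n) (hB : B.card = n)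
    (s : ℕ) (hs : s ≤ 1) :
    ∏ k : Fin n, wgt c (fun k => Xf (A.orderEmbOfFin hA) (k + s)) k ((B.orderEmbOfFin hB k : ℕ) + 1)
    = if ∀ k : Fin n, Xf (A.orderEmbOfFin hA) (k + s) ≤ (B.orderEmbOfFin hB k : ℕ) + 1 ∧
        (B.orderEmbOfFin hB k : ℕ) + 1 ≤ Xf (A.orderEmbOfFin hA) (k + s + 1)
      then (c : ℂ) ^ Pdiff A B else 0 := by
  split_ifs with h
  · rw [← prod_pow_Pdiff c A B hA hB]
    refine Finset.prod_congr rfl fun k _ => ?_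
    unfold wgt
    simp only [show (k : ℕ) + 1 + s = k + s + 1 by omega]
    rw [if_pos (h k)]
    have hm := Xf_mem (A.orderEmbOfFin hA) (A.orderEmbOfFin hA).strictMono (k + s)
      (by have := k.2; omega) (B.orderEmbOfFin hB k) (h k).1 (h k).2
    have hm2 : (∃ i, A.orderEmbOfFin hA i = B.orderEmbOfFin hB k) ↔ B.orderEmbOfFin hB k ∈ A := by
      rw [← Set.mem_range, Finset.range_orderEmbOfFin, Finset.mem_coe]
    rw [hm2] at hm
    simp only [hm]
  · push Not at h
    obtain ⟨k, hk⟩ := h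
    refine Finset.prod_eq_zero (Finset.mem_univ k) ?_
    unfold wgt
    rw [if_neg]
    rintro ⟨h1, h2⟩
    simp only [show (k : ℕ) + 1 + s = k + s + 1 by omega] at h2
    have := hk h1
    omega

lemma seqInterlace_iff {N n : ℕ} (A B : Finset (Fin N)) (hA : A.card = n) (hB : B.card = n) :
    seqInterlace (posList A) (posList B) ↔
      ∀ i (hi : i < n), A.orderEmbOfFin hA ⟨i, hi⟩ ≤ B.orderEmbOfFin hB ⟨i, hi⟩ ∧
        ∀ hi' : i + 1 < n, B.orderEmbOfFin hB ⟨i, hi⟩ ≤ A.orderEmbOfFin hA ⟨i + 1, hi'⟩ := by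
  unfold seqInterlace
  rw [posList_length, hA]
  refine forall_congr' fun i => forall_congr' fun hi => ?_
  rw [posList_getD A hA i hi, posList_getD B hB i hi, add_le_add_iff_right, ← Fin.le_def]
  refine and_congr_right fun _ => forall_congr' fun hi' => ?_
  rw [posList_getD A hA _ hi', add_le_add_iff_right, ← Fin.le_def]

lemma seq1 {N n : ℕ} (A B : Finset (Fin N)) (hA : A.card = n) (hB : B.card = n) :
    seqInterlace (posList A) (posList B) ↔
    ∀ k : Fin n, Xf (A.orderEmbOfFin hA) (k + 1) ≤ (B.orderEmbOfFin hB k : ℕ) + 1 ∧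
        (B.orderEmbOfFin hB k : ℕ) + 1 ≤ Xf (A.orderEmbOfFin hA) (k + 1 + 1) := by
  rw [seqInterlace_iff A B hA hB, Fin.forall_iff]
  refine forall_congr' fun i => forall_congr' fun hi => ?_
  simp only
  rw [Xf_succ _ i hi, add_le_add_iff_right, ← Fin.le_def]
  refine and_congr_right fun _ => ?_
  by_cases hi' : i + 1 < n
  · rw [Xf_succ _ _ hi', add_le_add_iff_right, ← Fin.le_def]
    exact ⟨fun h => h hi', fun h _ => h⟩
  · obtain rfl : i + 1 = n := by omega
    rw [Xf_last]
    have := (B.orderEmbOfFin hB ⟨i, hi⟩).2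
    exact ⟨fun _ => by omega, fun _ h => absurd h hi'⟩

lemma seq2 {N n : ℕ} (A B : Finset (Fin N)) (hA : A.card = n) (hB : B.card = n) :
    seqInterlace (posList B) (posList A) ↔
    ∀ k : Fin n, Xf (A.orderEmbOfFin hA) (k + 0) ≤ (B.orderEmbOfFin hB k : ℕ) + 1 ∧
        (B.orderEmbOfFin hB k : ℕ) + 1 ≤ Xf (A.orderEmbOfFin hA) (k + 0 + 1) := by
  rw [seqInterlace_iff B A hB hA, Fin.forall_iff]
  simp only [add_zero]
  constructor
  · intro h i hi
    rw [Xf_succ _ i hi, add_le_add_iff_right, ← Fin.le_def]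
    refine ⟨?_, (h i hi).1⟩
    cases i with
    | zero => simp [Xf]
    | succ i =>
      rw [Xf_succ _ i (by omega), add_le_add_iff_right, ← Fin.le_def]
      exact (h i (by omega)).2 hi
  · intro h i hi
    constructor
    · have := (h i hi).2
      rwa [Xf_succ _ i hi, add_le_add_iff_right, ← Fin.le_def] at this
    · intro hi'
      have := (h (i + 1) hi').1
      rwa [Xf_succ _ i hi, add_le_add_iff_right, ← Fin.le_def] at this

lemma V_eq {N n : ℕ} (c : ℝ) (A B : Finset (Fin N)) (hA : A.card = n) (hB : B.card = n) :
    transferV N c A B =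
    ∏ k : Fin n, wgt c (fun k => Xf (A.orderEmbOfFin hA) (k + 1)) k
      ((B.orderEmbOfFin hB k : ℕ) + 1) +
    ∏ k : Fin n, wgt c (Xf (A.orderEmbOfFin hA)) k ((B.orderEmbOfFin hB k : ℕ) + 1) := by
  classical
  have h1 := prod_wgt c A B hA hB 1 le_rfl
  have h2 := prod_wgt c A B hA hB 0 (by omega)
  simp only [← seq1 A B hA hB] at h1
  simp only [← seq2 A B hA hB] at h2
  simp only [add_zero] at h2
  rw [h1, h2]
  simp only [transferV, Matrix.of_apply]
  by_cases hAB : A = B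
  · subst hAB
    have hs : seqInterlace (posList A) (posList A) := by
      rw [seqInterlace_iff A A hA hA]
      refine fun i hi => ⟨le_rfl, fun hi' => (A.orderEmbOfFin hA).monotone ?_⟩
      rw [Fin.le_def]; simp
    have hP : Pdiff A A = 0 := by simp [Pdiff]
    rw [if_pos rfl, if_pos hs, hP]; norm_num
  · rw [if_neg hAB]
    have hnot : ¬ (seqInterlace (posList A) (posList B) ∧
        seqInterlace (posList B) (posList A)) := by
      rintro ⟨ha, hb⟩
      rw [seqInterlace_iff A B hA hB] at ha
      rw [seqInterlace_iff B A hB hA] at hb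
      apply hAB
      rw [← Finset.map_orderEmbOfFin_univ A hA, ← Finset.map_orderEmbOfFin_univ B hB]
      congr 2
      ext k
      exact congrArg _ (le_antisymm (ha k k.2).1 (hb k k.2).1)
    unfold Interlaced
    by_cases ha : seqInterlace (posList A) (posList B) <;>
      by_cases hb : seqInterlace (posList B) (posList A)
    · exact absurd ⟨ha, hb⟩ hnot
    all_goals simp [ha, hb, hA, hB]

open scoped Classical in
lemma sum_card {N n : ℕ} (f : Finset (Fin N) → ℂ) (hf : ∀ B, B.card ≠ n → f B = 0) :
    ∑ B, f B = ∑ y : Fin n → Fin N, if StrictMono y then f (Finset.univ.image y) else 0 := by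
  rw [← Finset.sum_filter, ← Finset.sum_filter_of_ne (p := fun B => B.card = n)
    (fun B _ h => by by_contra h'; exact h (hf B h'))]
  symm
  refine Finset.sum_bij' (fun y _ => Finset.univ.image y)
    (fun B hB => B.orderEmbOfFin (Finset.mem_filter.1 hB).2) ?_ ?_ ?_ ?_ ?_
  · intro y hy
    simp only [Finset.mem_filter, Finset.mem_univ, true_and] at hy ⊢
    rw [Finset.card_image_of_injective _ hy.injective]; simp
  · intro B hB
    simp only [Finset.mem_filter, Finset.mem_univ, true_and]
    exact (B.orderEmbOfFin _).strictMono
  · intro y hy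
    simp only [Finset.mem_filter, Finset.mem_univ, true_and] at hy
    exact (Finset.orderEmbOfFin_unique _ (fun k => Finset.mem_image_of_mem _ (Finset.mem_univ k))
      hy).symm
  · intro B hB
    exact Finset.image_orderEmbOfFin_univ B _
  · intro y _; rfl

lemma exp_Sfun (Δ a b : ℝ) : Complex.exp (Complex.I * (a : ℂ)) * Sfun Δ a b =
    1 + Complex.exp (Complex.I * (a : ℂ)) * Complex.exp (Complex.I * (b : ℂ))
      - 2 * (Δ : ℂ) * Complex.exp (Complex.I * (a : ℂ)) := by
  unfold Sfun
  have : Complex.exp (Complex.I * (a : ℂ)) * Complex.exp (-(Complex.I * (a : ℂ))) = 1 := by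
    rw [← Complex.exp_add]; simp
  linear_combination this

lemma hfac_eq {n : ℕ} (Δ : ℝ) (p : Fin n → ℝ) (u v : Fin n) :
    hfac Δ (zOf p) u v = Complex.exp (Complex.I * (p u : ℂ)) * Sfun Δ (p u) (p v) := by
  rw [exp_Sfun]; rfl

lemma Acoef_eq {n : ℕ} (Δ : ℝ) (p : Fin n → ℝ) (σ : Equiv.Perm (Fin n)) :
    Acoef Δ p σ = Ac Δ (zOf p) σ := by
  unfold Acoef Ac
  simp only [hfac_eq]

lemma psi_eq {N n : ℕ} (Δ : ℝ) (p : Fin n → ℝ) (B : Finset (Fin N)) (hB : B.card = n) :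
    psiVec N n Δ p B = ∑ σ : Equiv.Perm (Fin n), Ac Δ (zOf p) σ *
      ∏ k : Fin n, zOf p (σ k) ^ ((B.orderEmbOfFin hB k : ℕ) + 1) := by
  unfold psiVec
  rw [dif_pos hB]
  refine Finset.sum_congr rfl fun σ _ => ?_
  rw [Acoef_eq]
  congr 1
  refine Finset.prod_congr rfl fun k _ => ?_
  rw [Finset.coe_orderIsoOfFin_apply, zOf, ← Complex.exp_nat_mul, mul_comm]

lemma mulVec_eq {N n : ℕ} (c Δ : ℝ) (p : Fin n → ℝ) (A : Finset (Fin N)) (hA : A.card = n) :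
    (transferV N c).mulVec (psiVec N n Δ p) A =
    ∑ σ : Equiv.Perm (Fin n), Ac Δ (zOf p) σ *
      Zsum N n (gf c (fun k => Xf (A.orderEmbOfFin hA) (k + 1)) (zOf p) σ) +
    ∑ σ : Equiv.Perm (Fin n), Ac Δ (zOf p) σ *
      Zsum N n (gf c (Xf (A.orderEmbOfFin hA)) (zOf p) σ) := by
  classical
  simp only [Matrix.mulVec, dotProduct]
  rw [sum_card (n := n) _ (fun B hB => by unfold psiVec; rw [dif_neg hB, mul_zero])]
  have hz : ∀ (σ : Equiv.Perm (Fin n)) (k : Fin n), zext (zOf p) σ k = zOf p (σ k) := by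
    intro σ k; unfold zext; rw [dif_pos k.2]
  unfold Zsum
  simp only [Finset.mul_sum]
  rw [Finset.sum_comm, Finset.sum_comm (s := (Finset.univ : Finset (Equiv.Perm (Fin n)))),
    ← Finset.sum_add_distrib]
  refine Finset.sum_congr rfl fun y _ => ?_
  rw [← Finset.sum_add_distrib]
  split_ifs with hy
  · have hB : (Finset.univ.image y).card = n := by
      rw [Finset.card_image_of_injective _ hy.injective]; simp
    have hyB : y = (Finset.univ.image y).orderEmbOfFin hB :=
      Finset.orderEmbOfFin_unique _ (fun k => Finset.mem_image_of_mem _ (Finset.mem_univ k)) hy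
    rw [V_eq c A _ hA hB, psi_eq Δ p _ hB, ← hyB, Finset.mul_sum]
    refine Finset.sum_congr rfl fun σ _ => ?_
    simp only [gf, Finset.prod_mul_distrib, hz]
    ring
  · simp

lemma zOf_ne_one {n : ℕ} (Δ : ℝ) (p : Fin n → ℝ) (hpD : ∀ j, p j ∈ Ddom Δ)
    (hnonzero : ∀ j, p j ≠ 0) (j : Fin n) : zOf p j ≠ 1 := by
  have hmu : 0 ≤ muD Δ := by
    unfold muD; split_ifs
    · exact Real.arccos_nonneg _
    · exact le_rfl
  have h1 := (hpD j).1
  have h2 := (hpD j).2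
  intro h
  unfold zOf at h
  rw [Complex.exp_eq_one_iff] at h
  obtain ⟨m, hm⟩ := h
  have hm' : (p j : ℂ) = ((m * (2 * Real.pi) : ℝ) : ℂ) := by
    apply mul_left_cancel₀ Complex.I_ne_zero
    rw [hm]; push_cast; ring
  have hm2 : p j = m * (2 * Real.pi) := by exact_mod_cast hm'
  have hpi := Real.pi_pos
  have l1 : (m : ℝ) < 1 := by
    by_contra hcon
    push Not at hcon
    nlinarith
  have l2 : (-1 : ℝ) < m := by
    by_contra hcon
    push Not at hcon
    nlinarith
  have l1' : m < 1 := by exact_mod_cast l1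
  have l2' : -1 < m := by exact_mod_cast l2
  obtain rfl : m = 0 := by omega
  apply hnonzero j
  rw [hm2]; simp

/-- **Bethe ansatz for the six-vertex transfer matrix, non-singular case.** -/
theorem bethe_ansatz_nonsingular
    (N n : ℕ) (hN : 0 < N) (hn : 2 * n ≤ N)
    (c : ℝ) (hc : 0 < c) (Δ : ℝ) (hΔ : Δ = (2 - c ^ 2) / 2)
    (Θ : ℝ → ℝ → ℝ)
    (hΘcont : ContinuousOn (fun q : ℝ × ℝ => Θ q.1 q.2) (Ddom Δ ×ˢ Ddom Δ))
    (hΘzero : Θ 0 0 = 0)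
    (hΘ : ∀ a ∈ Ddom Δ, ∀ b ∈ Ddom Δ,
      Complex.exp (-(Complex.I * (Θ a b : ℂ))) =
        Complex.exp (Complex.I * ((a : ℂ) - (b : ℂ))) * Sfun Δ a b / Sfun Δ b a)
    (p : Fin n → ℝ) (hpD : ∀ j, p j ∈ Ddom Δ)
    (hdistinct : Function.Injective p)
    (hnonzero : ∀ j, p j ≠ 0)
    (hBE : ∀ j, Complex.exp (Complex.I * (N : ℂ) * (p j : ℂ)) =
      (-1 : ℂ) ^ (n - 1) *
        Complex.exp (-(Complex.I * ((∑ k, Θ (p j) (p k) : ℝ) : ℂ))))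
    :
    (transferV N c).mulVec (psiVec N n Δ p) =
      ((∏ j, Lfun c (zOf p j)) + (∏ j, Mfun c (zOf p j))) • psiVec N n Δ p := by

  have hS : ∀ j k, Sfun Δ (p j) (p k) ≠ 0 := by
    intro j k h0
    have := hΘ (p k) (hpD k) (p j) (hpD j)
    rw [h0, div_zero] at this
    exact Complex.exp_ne_zero _ this
  have hne : ∀ j k, hfac Δ (zOf p) j k ≠ 0 := by
    intro j k
    rw [hfac_eq]
    exact mul_ne_zero (Complex.exp_ne_zero _) (hS j k)
  have hT : ∀ j k, Complex.exp (-(Complex.I * (Θ (p j) (p k) : ℂ))) =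
      hfac Δ (zOf p) j k / hfac Δ (zOf p) k j := by
    intro j k
    rw [hΘ _ (hpD j) _ (hpD k), hfac_eq, hfac_eq, mul_sub, Complex.exp_sub]
    have e1 := hS j k
    have e2 := hS k j
    have e3 := Complex.exp_ne_zero (Complex.I * (p k : ℂ))
    field_simp
  have hB : ∀ j, zOf p j ^ N =
      (-1) ^ (n - 1) * ∏ k, (hfac Δ (zOf p) j k / hfac Δ (zOf p) k j) := by
    intro j
    have h1 : zOf p j ^ N = Complex.exp (Complex.I * (N : ℂ) * (p j : ℂ)) := by
      rw [zOf, ← Complex.exp_nat_mul]; congr 1; ring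
    rw [h1, hBE j]
    congr 1
    rw [Complex.ofReal_sum, Finset.mul_sum, ← Finset.sum_neg_distrib, Complex.exp_sum]
    exact Finset.prod_congr rfl fun k _ => hT j k
  funext A
  rw [Pi.smul_apply, smul_eq_mul]
  by_cases hA : A.card = n
  · have hx := (A.orderEmbOfFin hA).strictMono
    have hXlt := Xf_lt (A.orderEmbOfFin hA) hx
    have hl := Xf_last (A.orderEmbOfFin hA)
    have h0 : Xf (A.orderEmbOfFin hA) 0 = 0 := rfl
    rw [mulVec_eq c Δ p A hA,
      core N n c Δ hΔ (zOf p) (zOf_ne_one Δ p hpD hnonzero) hne hB (Xf (A.orderEmbOfFin hA))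
        h0 hl
        (fun k hk => hXlt _ _ (by omega) (by omega))
        (fun k h1 h2 => by have := hXlt 0 k h1 (by omega); omega)
        (fun k h1 h2 => by have := hXlt k (n + 1) (by omega) le_rfl; omega),
      psi_eq Δ p A hA]
    congr 1
    refine Finset.sum_congr rfl fun σ _ => ?_
    congr 1
    refine Finset.prod_congr rfl fun k _ => ?_
    rw [Xf_succ _ k k.2]
  · have h1 : psiVec N n Δ p A = 0 := by unfold psiVec; rw [dif_neg hA]
    rw [h1, mul_zero]
    simp only [Matrix.mulVec, dotProduct]
    refine Finset.sum_eq_zero fun B _ => ?_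
    by_cases hBc : B.card = n
    · have hV : transferV N c A B = 0 := by
        simp only [transferV, Matrix.of_apply]
        rw [if_neg (by rintro rfl; exact hA hBc), if_neg]
        intro h
        exact hA (h.1.trans hBc)
      rw [hV, zero_mul]
    · unfold psiVec; rw [dif_neg hBc, mul_zero]
end
end

section
/- Let N be a positive integer, c > 0, and n ≤ N/2. Suppose p₁,…,pₙ ∈ D_Δ are distinct, satisfy the Bethe equations exp(iNp_j) = (−1)^{n−1} exp(−i Σ_{k=1}^n Θ(p_j,p_k)) for every j, and that p_ℓ = 0 for some (necessarily unique) index ℓ. Then the Bethe ansatz vector ψ satisfies V ψ = Λ ψ, where Λ = [2 + c²(N−1) + c² Σ_{j≠ℓ} ∂₁Θ(0,p_j)] · Π_{j≠ℓ} M(e^{ip_j}), with ∂₁Θ the partial derivative of Θ in its first variable. -/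
open scoped BigOperators
open Complex

noncomputable section

namespace BA

def ss (C w z : ℂ) : ℂ := 1 + w * z - (2 - C) * w
def LL (C z : ℂ) : ℂ := 1 + C * z / (1 - z)
def MM (C z : ℂ) : ℂ := 1 - C / (1 - z)

def AA (C : ℂ) {n : ℕ} (z : Fin n → ℂ) (σ : Equiv.Perm (Fin n)) : ℂ :=
  ((Equiv.Perm.sign σ : ℤ) : ℂ) *
    ∏ kl ∈ Finset.univ.filter (fun kl : Fin n × Fin n => kl.1 < kl.2),
      ss C (z (σ kl.1)) (z (σ kl.2))

lemma ML_sub (C z w : ℂ) (hz : z ≠ 1) (hw : w ≠ 1) :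
    MM C z * LL C w - 1 = -C * ss C w z / ((1 - z) * (1 - w)) := by
  have h1 : (1 - z) ≠ 0 := sub_ne_zero.mpr hz.symm
  have h2 : (1 - w) ≠ 0 := sub_ne_zero.mpr hw.symm
  unfold MM LL ss
  field_simp
  ring

lemma swap_lt {n : ℕ} (j j' k l : Fin n) (h : j'.val = j.val + 1) (hkl : k < l)
    (hne : (k, l) ≠ (j, j')) : Equiv.swap j j' k < Equiv.swap j j' l := by
  have hne' : ¬ (k.val = j.val ∧ l.val = j'.val) := by
    rintro ⟨h1, h2⟩
    exact hne (Prod.ext (Fin.ext h1) (Fin.ext h2))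
  simp only [Equiv.swap_apply_def]
  rw [Fin.lt_def] at *
  split_ifs <;> simp_all [Fin.ext_iff] <;> omega

lemma AA_swap (C : ℂ) {n : ℕ} (z : Fin n → ℂ) (σ : Equiv.Perm (Fin n)) (j j' : Fin n)
    (h : j'.val = j.val + 1) :
    AA C z (σ * Equiv.swap j j') * ss C (z (σ j)) (z (σ j')) =
      - (AA C z σ * ss C (z (σ j')) (z (σ j))) := by
  have hjj : j < j' := by rw [Fin.lt_def]; omega
  have hmem : (j, j') ∈ Finset.univ.filter (fun kl : Fin n × Fin n => kl.1 < kl.2) := by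
    simpa using hjj
  unfold AA
  rw [← Finset.mul_prod_erase _ _ hmem, ← Finset.mul_prod_erase _ _ hmem]
  have hprod : ∏ kl ∈ (Finset.univ.filter (fun kl : Fin n × Fin n => kl.1 < kl.2)).erase (j, j'),
      ss C (z ((σ * Equiv.swap j j') kl.1)) (z ((σ * Equiv.swap j j') kl.2)) =
      ∏ kl ∈ (Finset.univ.filter (fun kl : Fin n × Fin n => kl.1 < kl.2)).erase (j, j'),
      ss C (z (σ kl.1)) (z (σ kl.2)) := by
    have key : ∀ a ∈ (Finset.univ.filter (fun kl : Fin n × Fin n => kl.1 < kl.2)).erase (j, j'),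
        (Equiv.swap j j' a.1, Equiv.swap j j' a.2) ∈
        (Finset.univ.filter (fun kl : Fin n × Fin n => kl.1 < kl.2)).erase (j, j') := by
      rintro ⟨k, l⟩ ha
      simp only [Finset.mem_erase, Finset.mem_filter, Finset.mem_univ, true_and] at ha ⊢
      refine ⟨?_, swap_lt j j' k l h ha.2 ha.1⟩
      intro heq
      simp only [Prod.mk.injEq] at heq
      have h1 : k = j' := by
        have := congrArg (Equiv.swap j j') heq.1
        simpa using this
      have h2 : l = j := by
        have := congrArg (Equiv.swap j j') heq.2
        simpa using this
      have := ha.2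
      rw [h1, h2] at this
      exact absurd this (not_lt.mpr hjj.le)
    refine Finset.prod_bij' (fun a _ => (Equiv.swap j j' a.1, Equiv.swap j j' a.2))
      (fun a _ => (Equiv.swap j j' a.1, Equiv.swap j j' a.2)) key key ?_ ?_ ?_
    · intro a _; simp
    · intro a _; simp
    · intro a _; simp
  rw [hprod]
  have hsign : Equiv.Perm.sign (σ * Equiv.swap j j') = - Equiv.Perm.sign σ := by
    rw [Equiv.Perm.sign_mul, Equiv.Perm.sign_swap hjj.ne]; simp
  rw [hsign]
  simp only [Equiv.Perm.mul_apply, Equiv.swap_apply_left, Equiv.swap_apply_right]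
  push_cast
  ring

lemma anti (C : ℂ) {n : ℕ} (z : Fin n → ℂ) (j j' : Fin n)
    (h : j'.val = j.val + 1) (f : Equiv.Perm (Fin n) → ℂ)
    (hf : ∀ σ, f (σ * Equiv.swap j j') = f σ)
    (hz : ∀ σ, f σ ≠ 0 → z (σ j) ≠ 1 ∧ z (σ j') ≠ 1) :
    ∑ σ, AA C z σ * ((MM C (z (σ j)) * LL C (z (σ j')) - 1) * f σ) = 0 := by
  set F : Equiv.Perm (Fin n) → ℂ := fun σ =>
    AA C z σ * ((MM C (z (σ j)) * LL C (z (σ j')) - 1) * f σ) with hF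
  have hneg : ∀ σ, F (σ * Equiv.swap j j') = - F σ := by
    intro σ
    simp only [hF, hf, Equiv.Perm.mul_apply, Equiv.swap_apply_left, Equiv.swap_apply_right]
    by_cases h0 : f σ = 0
    · simp [h0]
    · obtain ⟨h1, h2⟩ := hz σ h0
      rw [ML_sub C _ _ h1 h2, ML_sub C _ _ h2 h1]
      have hs := AA_swap C z σ j j' h
      have h1' : (1 - z (σ j)) ≠ 0 := sub_ne_zero.mpr h1.symm
      have h2' : (1 - z (σ j')) ≠ 0 := sub_ne_zero.mpr h2.symm
      field_simp
      linear_combination (-C) * hs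
  have h1 : ∑ σ, F σ = ∑ σ, F (σ * Equiv.swap j j') :=
    (Equiv.sum_comp (Equiv.mulRight (Equiv.swap j j')) F).symm
  have h2 : ∑ σ, F (σ * Equiv.swap j j') = - ∑ σ, F σ := by
    rw [← Finset.sum_neg_distrib]
    exact Finset.sum_congr rfl (fun σ _ => hneg σ)
  have h3 : ∑ σ, F σ = - ∑ σ, F σ := h1.trans h2
  exact self_eq_neg.mp h3

lemma AA_rot (C : ℂ) {m : ℕ} (z : Fin (m+1) → ℂ) (σ : Equiv.Perm (Fin (m+1))) :
    AA C z (σ * finRotate (m+1)) * ∏ k : Fin m, ss C (z (σ 0)) (z (σ k.succ)) =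
      (-1) ^ m * AA C z σ * ∏ k : Fin m, ss C (z (σ k.succ)) (z (σ 0)) := by
  have e : ∀ τ : Equiv.Perm (Fin (m+1)), ∏ kl ∈ Finset.univ.filter
      (fun kl : Fin (m+1) × Fin (m+1) => kl.1 < kl.2), ss C (z (τ kl.1)) (z (τ kl.2)) =
      ∏ k, ∏ l, if k < l then ss C (z (τ k)) (z (τ l)) else 1 := by
    intro τ
    rw [Finset.prod_filter, Fintype.prod_prod_type]
  unfold AA
  rw [e, e]
  have h1 : (∏ k, ∏ l, if k < l then ss C (z (σ k)) (z (σ l)) else 1) =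
      (∏ k : Fin m, ss C (z (σ 0)) (z (σ k.succ))) *
      ∏ k : Fin m, ∏ l : Fin m, if k < l then ss C (z (σ k.succ)) (z (σ l.succ)) else 1 := by
    rw [Fin.prod_univ_succ]
    congr 1
    · rw [Fin.prod_univ_succ]; simp
    · refine Finset.prod_congr rfl (fun k _ => ?_)
      rw [Fin.prod_univ_succ]; simp
  have h2 : (∏ k, ∏ l, if k < l then ss C (z ((σ * finRotate (m+1)) k))
        (z ((σ * finRotate (m+1)) l)) else 1) =
      (∏ k : Fin m, ss C (z (σ k.succ)) (z (σ 0))) *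
      ∏ k : Fin m, ∏ l : Fin m, if k < l then ss C (z (σ k.succ)) (z (σ l.succ)) else 1 := by
    rw [Fin.prod_univ_castSucc]
    have : ∀ k : Fin m, (∏ l, if k.castSucc < l then ss C (z ((σ * finRotate (m+1)) k.castSucc))
        (z ((σ * finRotate (m+1)) l)) else 1) =
        (∏ l : Fin m, if k < l then ss C (z (σ k.succ)) (z (σ l.succ)) else 1) *
          ss C (z (σ k.succ)) (z (σ 0)) := by
      intro k
      rw [Fin.prod_univ_castSucc]
      simp [Fin.castSucc_lt_last]
    rw [Finset.prod_congr rfl (fun k _ => this k), Finset.prod_mul_distrib]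
    have h3 : (∏ l, if Fin.last m < l then ss C (z ((σ * finRotate (m+1)) (Fin.last m)))
        (z ((σ * finRotate (m+1)) l)) else 1) = 1 := by
      refine Finset.prod_eq_one (fun l _ => ?_)
      rw [if_neg (not_lt.mpr (Fin.le_last l))]
    rw [h3]; ring
  rw [h1, h2]
  have hs : Equiv.Perm.sign (σ * finRotate (m+1)) = Equiv.Perm.sign σ * (-1) ^ m := by
    rw [Equiv.Perm.sign_mul, sign_finRotate, Nat.add_sub_cancel]
  rw [hs]
  push_cast
  ring

/-- continuant -/
def Tc (α e : ℕ → ℂ) : ℕ → ℕ → ℂ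
  | 0, _ => 1
  | 1, k => α k
  | (r+2), k => α k * Tc α e (r+1) (k+1) - e k * Tc α e r (k+2)

lemma Tc_congr (α e α' e' : ℕ → ℂ) (r : ℕ) : ∀ k,
    (∀ i, k ≤ i → i < k + r → α i = α' i) → (∀ i, k ≤ i → i + 1 < k + r → e i = e' i) →
    Tc α e r k = Tc α' e' r k := by
  induction r using Nat.strong_induction_on with
  | _ r ih =>
    intro k h1 h2
    match r, ih with
    | 0, _ => rfl
    | 1, _ => exact h1 k le_rfl (by omega)
    | (r+2), ih =>
      simp only [Tc]
      rw [h1 k le_rfl (by omega), h2 k le_rfl (by omega),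
        ih (r+1) (by omega) (k+1) (fun i hi hi' => h1 i (by omega) (by omega))
          (fun i hi hi' => h2 i (by omega) (by omega)),
        ih r (by omega) (k+2) (fun i hi hi' => h1 i (by omega) (by omega))
          (fun i hi hi' => h2 i (by omega) (by omega))]

lemma Tc_shift (α e : ℕ → ℂ) (r : ℕ) : ∀ k,
    Tc (fun i => α (i+1)) (fun i => e (i+1)) r k = Tc α e r (k+1) := by
  induction r using Nat.strong_induction_on with
  | _ r ih =>
    intro k
    match r, ih with
    | 0, _ => rfl
    | 1, _ => rfl
    | (r+2), ih =>
      simp only [Tc]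
      rw [ih (r+1) (by omega) (k+1), ih r (by omega) (k+2)]

lemma Tc_last (α α' e : ℕ → ℂ) (β : ℂ) (r : ℕ) : ∀ k,
    (∀ i, k ≤ i → i < k + r → α' i = α i) → α' (k+r) = α (k+r) + β →
    Tc α' e (r+1) k = Tc α e (r+1) k + β * Tc α e r k := by
  induction r using Nat.strong_induction_on with
  | _ r ih =>
    intro k h1 h2
    match r, ih with
    | 0, _ => simpa [Tc] using h2
    | 1, _ =>
      have h2' : α' (k+1) = α (k+1) + β := h2
      simp only [Tc]
      rw [h1 k le_rfl (by omega), h2']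
      ring
    | (r+2), ih =>
      have e1 : Tc α' e (r+2+1) k = α' k * Tc α' e (r+2) (k+1) - e k * Tc α' e (r+1) (k+2) := rfl
      have e2 : Tc α e (r+2+1) k = α k * Tc α e (r+2) (k+1) - e k * Tc α e (r+1) (k+2) := rfl
      have e3 : Tc α e (r+2) k = α k * Tc α e (r+1) (k+1) - e k * Tc α e (r) (k+2) := rfl
      rw [e1, e2, e3, h1 k le_rfl (by omega),
        ih (r+1) (by omega) (k+1) (fun i hi hi' => h1 i (by omega) (by omega))
          (by rw [show k+1+(r+1) = k+(r+2) by omega]; exact h2),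
        ih r (by omega) (k+2) (fun i hi hi' => h1 i (by omega) (by omega))
          (by rw [show k+2+r = k+(r+2) by omega]; exact h2)]
      ring

lemma Tc_tendsto {ι : Type*} (l : Filter ι) (α e : ι → ℕ → ℂ) (α' e' : ℕ → ℂ)
    (h1 : ∀ i, Filter.Tendsto (fun u => α u i) l (nhds (α' i)))
    (h2 : ∀ i, Filter.Tendsto (fun u => e u i) l (nhds (e' i))) (r : ℕ) : ∀ k,
    Filter.Tendsto (fun u => Tc (α u) (e u) r k) l (nhds (Tc α' e' r k)) := by
  induction r using Nat.strong_induction_on with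
  | _ r ih =>
    intro k
    match r, ih with
    | 0, _ => exact tendsto_const_nhds
    | 1, _ => exact h1 k
    | (r+2), ih =>
      exact ((h1 k).mul (ih (r+1) (by omega) (k+1))).sub ((h2 k).mul (ih r (by omega) (k+2)))

def idx (m k : ℕ) : Fin (m+1) := Fin.ofNat (m+1) k

lemma idx_val {m k : ℕ} (h : k ≤ m) : (idx m k).val = k := by
  simp only [idx, Fin.ofNat]
  exact Nat.mod_eq_of_lt (by omega)

lemma idx_inj {m k l : ℕ} (h : k ≤ m) (h' : l ≤ m) (e : idx m k = idx m l) : k = l := by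
  have := congrArg Fin.val e
  rwa [idx_val h, idx_val h'] at this

lemma idx_fin {m : ℕ} (k : Fin (m+1)) : idx m k.val = k :=
  Fin.ext (idx_val (by omega))

def sw (m j : ℕ) : Equiv.Perm (Fin (m+1)) := Equiv.swap (idx m j) (idx m (j+1))

lemma sw_of_ne {m : ℕ} (σ : Equiv.Perm (Fin (m+1))) {i j : ℕ} (hi : i ≤ m) (hj : j < m)
    (h1 : i ≠ j) (h2 : i ≠ j + 1) : (σ * sw m j) (idx m i) = σ (idx m i) := by
  rw [Equiv.Perm.mul_apply, sw, Equiv.swap_apply_of_ne_of_ne]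
  · exact fun h => h1 (idx_inj hi hj.le h)
  · exact fun h => h2 (idx_inj hi hj h)

lemma sw_left {m : ℕ} (σ : Equiv.Perm (Fin (m+1))) (j : ℕ) :
    (σ * sw m j) (idx m j) = σ (idx m (j+1)) := by
  rw [Equiv.Perm.mul_apply, sw, Equiv.swap_apply_left]

lemma sw_right {m : ℕ} (σ : Equiv.Perm (Fin (m+1))) (j : ℕ) :
    (σ * sw m j) (idx m (j+1)) = σ (idx m j) := by
  rw [Equiv.Perm.mul_apply, sw, Equiv.swap_apply_right]

def al {m : ℕ} (la lb : ℕ → Fin (m+1) → ℂ) (σ : Equiv.Perm (Fin (m+1))) (k : ℕ) : ℂ :=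
  la k (σ (idx m k)) + lb k (σ (idx m k))

def ee {m : ℕ} (z : Fin (m+1) → ℂ) (X : ℕ → ℕ) (σ : Equiv.Perm (Fin (m+1))) (k : ℕ) : ℂ :=
  (z (σ (idx m k)) * z (σ (idx m (k+1)))) ^ X (k+1)

def Inv {m : ℕ} (k : ℕ) (h : Equiv.Perm (Fin (m+1)) → ℂ) : Prop :=
  ∀ j, k ≤ j → j < m → ∀ σ, h (σ * sw m j) = h σ

lemma Inv.mono {m k k' : ℕ} {h : Equiv.Perm (Fin (m+1)) → ℂ} (H : Inv k h) (hk : k ≤ k') :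
    Inv k' h := fun j hj => H j (hk.trans hj)

lemma Inv.mul {m k : ℕ} {h h' : Equiv.Perm (Fin (m+1)) → ℂ} (H : Inv k h) (H' : Inv k h') :
    Inv k (fun σ => h σ * h' σ) := fun j hj hjm σ => by
  simp only [H j hj hjm σ, H' j hj hjm σ]

lemma Inv.pos {m k i : ℕ} (f : Fin (m+1) → ℂ) (hi : i < k) (hm : i ≤ m) :
    Inv k (fun σ : Equiv.Perm (Fin (m+1)) => f (σ (idx m i))) := fun j hj hjm σ => by
  simp only [sw_of_ne σ hm hjm (show i ≠ j by omega) (show i ≠ j+1 by omega)]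

lemma Tc_sw {m : ℕ} (z : Fin (m+1) → ℂ) (X : ℕ → ℕ) (la lb : ℕ → Fin (m+1) → ℂ)
    (σ : Equiv.Perm (Fin (m+1))) (j r k : ℕ) (hj : j < m) (hk : j + 2 ≤ k) (hr : k + r ≤ m + 1) :
    Tc (al la lb (σ * sw m j)) (ee z X (σ * sw m j)) r k = Tc (al la lb σ) (ee z X σ) r k := by
  apply Tc_congr
  · intro i hi hi'
    simp only [al, sw_of_ne σ (show i ≤ m by omega) hj (show i ≠ j by omega)
      (show i ≠ j+1 by omega)]
  · intro i hi hi'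
    simp only [ee, sw_of_ne σ (show i ≤ m by omega) hj (show i ≠ j by omega)
      (show i ≠ j+1 by omega), sw_of_ne σ (show i + 1 ≤ m by omega) hj (show i + 1 ≠ j by omega)
      (show i + 1 ≠ j+1 by omega)]

lemma Wsum (C : ℂ) {m : ℕ} (z : Fin (m+1) → ℂ) (X : ℕ → ℕ) (la lb : ℕ → Fin (m+1) → ℂ)
    (hb : ∀ k j, k < m → lb k j = MM C (z j) * z j ^ X (k+1))
    (ha : ∀ k j, k < m → la (k+1) j = LL C (z j) * z j ^ X (k+1)) (r : ℕ) :
    ∀ (k : ℕ) (h : Equiv.Perm (Fin (m+1)) → ℂ), k + r = m → Inv k h →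
    (∀ σ, h σ ≠ 0 → ∀ i, k ≤ i → i ≤ m → z (σ (idx m i)) ≠ 1) →
    ∑ σ, AA C z σ * (h σ * (Tc (al la lb σ) (ee z X σ) (r+1) k
        - la k (σ (idx m k)) * Tc (al la lb σ) (ee z X σ) r (k+1))) =
    ∑ σ, AA C z σ * (h σ * ∏ i ∈ Finset.range (r+1), lb (k+i) (σ (idx m (k+i)))) := by
  induction r with
  | zero =>
    intro k h hk hinv hz
    refine Finset.sum_congr rfl (fun σ _ => ?_)
    simp [Tc, al]
  | succ r ih =>
    intro k h hk hinv hz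
    have step := ih (k+1) (fun σ => h σ * lb k (σ (idx m k))) (by omega)
      ((hinv.mono (by omega)).mul (Inv.pos (lb k) (by omega) (by omega)))
      (fun σ hσ i hi him => hz σ (left_ne_zero_of_mul hσ) i (by omega) him)
    have an := anti C z (idx m k) (idx m (k+1))
      (by rw [idx_val (by omega), idx_val (by omega)])
      (fun σ => h σ * (ee z X σ k * Tc (al la lb σ) (ee z X σ) r (k+2)))
      (by
        intro σ
        have h1 := hinv k le_rfl (by omega) σ
        have h2 := Tc_sw z X la lb σ k r (k+2) (by omega) le_rfl (by omega)
        have h3 : ee z X (σ * sw m k) k = ee z X σ k := by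
          simp only [ee, sw_left, sw_right]; rw [mul_comm]
        show h (σ * sw m k) * (ee z X (σ * sw m k) k *
          Tc (al la lb (σ * sw m k)) (ee z X (σ * sw m k)) r (k+2)) = _
        rw [h1, h2, h3])
      (by
        intro σ hσ
        have := hz σ (left_ne_zero_of_mul hσ)
        exact ⟨this k le_rfl (by omega), this (k+1) (by omega) (by omega)⟩)
    have e1 : ∑ σ, AA C z σ * (h σ * (Tc (al la lb σ) (ee z X σ) (r+1+1) k
        - la k (σ (idx m k)) * Tc (al la lb σ) (ee z X σ) (r+1) (k+1))) =
        (∑ σ, AA C z σ * (h σ * lb k (σ (idx m k)) *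
          (Tc (al la lb σ) (ee z X σ) (r+1) (k+1)
        - la (k+1) (σ (idx m (k+1))) * Tc (al la lb σ) (ee z X σ) r (k+1+1)))) +
        ∑ σ, AA C z σ * ((MM C (z (σ (idx m k))) * LL C (z (σ (idx m (k+1)))) - 1) *
          (h σ * (ee z X σ k * Tc (al la lb σ) (ee z X σ) r (k+2)))) := by
      rw [← Finset.sum_add_distrib]
      refine Finset.sum_congr rfl (fun σ _ => ?_)
      have t : Tc (al la lb σ) (ee z X σ) (r+1+1) k = al la lb σ k *
        Tc (al la lb σ) (ee z X σ) (r+1) (k+1) - ee z X σ k *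
        Tc (al la lb σ) (ee z X σ) r (k+2) := rfl
      have q : lb k (σ (idx m k)) * la (k+1) (σ (idx m (k+1))) =
          MM C (z (σ (idx m k))) * LL C (z (σ (idx m (k+1)))) * ee z X σ k := by
        rw [hb k _ (by omega), ha k _ (by omega), ee, mul_pow]; ring
      rw [t]
      have q' : al la lb σ k = la k (σ (idx m k)) + lb k (σ (idx m k)) := rfl
      rw [q']
      linear_combination (AA C z σ * h σ * Tc (al la lb σ) (ee z X σ) r (k+2)) * q
    rw [e1, an, add_zero, step]
    refine Finset.sum_congr rfl (fun σ _ => ?_)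
    rw [Finset.prod_range_succ' _ (r+1)]
    have e2 : ∏ i ∈ Finset.range (r+1), lb (k+(i+1)) (σ (idx m (k+(i+1)))) =
        ∏ i ∈ Finset.range (r+1), lb (k+1+i) (σ (idx m (k+1+i))) :=
      Finset.prod_congr rfl (fun i _ => by rw [show k+(i+1) = k+1+i by omega])
    rw [e2, add_zero]
    ring

lemma Asum (C : ℂ) {m : ℕ} (z : Fin (m+1) → ℂ) (X : ℕ → ℕ) (la lb : ℕ → Fin (m+1) → ℂ)
    (hb : ∀ k j, k < m → lb k j = MM C (z j) * z j ^ X (k+1))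
    (ha : ∀ k j, k < m → la (k+1) j = LL C (z j) * z j ^ X (k+1))
    (h0 : ∀ j, lb m j = 0) (r : ℕ) :
    ∀ (k : ℕ) (h : Equiv.Perm (Fin (m+1)) → ℂ), k + r = m + 1 → Inv k h →
    (∀ σ, h σ ≠ 0 → ∀ i, k ≤ i → i ≤ m → z (σ (idx m i)) ≠ 1) →
    ∑ σ, AA C z σ * (h σ * Tc (al la lb σ) (ee z X σ) r k) =
    ∑ σ, AA C z σ * (h σ * ∏ i ∈ Finset.range r, la (k+i) (σ (idx m (k+i)))) := by
  induction r with
  | zero =>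
    intro k h hk hinv hz
    simp [Tc]
  | succ r ih =>
    intro k h hk hinv hz
    have w := Wsum C z X la lb hb ha r k h (by omega) hinv hz
    have w0 : ∑ σ, AA C z σ * (h σ * ∏ i ∈ Finset.range (r+1), lb (k+i) (σ (idx m (k+i)))) = 0 := by
      refine Finset.sum_eq_zero (fun σ _ => ?_)
      rw [Finset.prod_range_succ, show k + r = m by omega, h0]
      ring
    have step := ih (k+1) (fun σ => h σ * la k (σ (idx m k))) (by omega)
      ((hinv.mono (by omega)).mul (Inv.pos (la k) (by omega) (by omega)))
      (fun σ hσ i hi him => hz σ (left_ne_zero_of_mul hσ) i (by omega) him)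
    have e1 : ∑ σ, AA C z σ * (h σ * Tc (al la lb σ) (ee z X σ) (r+1) k) =
        ∑ σ, AA C z σ * (h σ * (Tc (al la lb σ) (ee z X σ) (r+1) k
        - la k (σ (idx m k)) * Tc (al la lb σ) (ee z X σ) r (k+1))) +
        ∑ σ, AA C z σ * (h σ * la k (σ (idx m k)) * Tc (al la lb σ) (ee z X σ) r (k+1)) := by
      rw [← Finset.sum_add_distrib]
      refine Finset.sum_congr rfl (fun σ _ => ?_)
      ring
    rw [e1, w, w0, zero_add, step]
    refine Finset.sum_congr rfl (fun σ _ => ?_)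
    rw [Finset.prod_range_succ' _ r]
    have e2 : ∏ i ∈ Finset.range r, la (k+(i+1)) (σ (idx m (k+(i+1)))) =
        ∏ i ∈ Finset.range r, la (k+1+i) (σ (idx m (k+1+i))) :=
      Finset.prod_congr rfl (fun i _ => by rw [show k+(i+1) = k+1+i by omega])
    rw [e2, add_zero]
    ring

def psi (C : ℂ) {m : ℕ} (z : Fin (m+1) → ℂ) (xs : ℕ → ℕ) : ℂ :=
  ∑ σ, AA C z σ * ∏ i ∈ Finset.range (m+1), z (σ (idx m i)) ^ xs i

def X2 (xs : ℕ → ℕ) : ℕ → ℕ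
  | 0 => 0
  | (k+1) => xs k

def la1 (C : ℂ) {m : ℕ} (z : Fin (m+1) → ℂ) (xs : ℕ → ℕ) (k : ℕ) (j : Fin (m+1)) : ℂ :=
  LL C (z j) * z j ^ xs k

def lb1 (C : ℂ) {m : ℕ} (N : ℕ) (z : Fin (m+1) → ℂ) (xs : ℕ → ℕ) (k : ℕ) (j : Fin (m+1)) : ℂ :=
  if k < m then MM C (z j) * z j ^ xs (k+1) else - (LL C (z j) - 1) * z j ^ N

def la2 (C : ℂ) {m : ℕ} (z : Fin (m+1) → ℂ) (xs : ℕ → ℕ) : ℕ → Fin (m+1) → ℂ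
  | 0, j => LL C (z j) - 1
  | (k+1), j => LL C (z j) * z j ^ xs k

def lb2 (C : ℂ) {m : ℕ} (z : Fin (m+1) → ℂ) (xs : ℕ → ℕ) (k : ℕ) (j : Fin (m+1)) : ℂ :=
  MM C (z j) * z j ^ xs k

lemma prod_idx {m : ℕ} (f : Fin (m+1) → ℂ) (σ : Equiv.Perm (Fin (m+1))) :
    ∏ i ∈ Finset.range (m+1), f (σ (idx m i)) = ∏ j, f j := by
  rw [← Fin.prod_univ_eq_prod_range (fun i => f (σ (idx m i))) (m+1)]
  simp only [idx_fin]
  exact Equiv.prod_comp σ f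

lemma Inv_one {m k : ℕ} : Inv k (fun _ : Equiv.Perm (Fin (m+1)) => (1:ℂ)) :=
  fun _ _ _ _ => rfl

lemma off2 (C : ℂ) {m : ℕ} (z : Fin (m+1) → ℂ) (xs : ℕ → ℕ) (hz : ∀ j, z j ≠ 1) :
    ∑ σ, AA C z σ * Tc (al (la2 C z xs) (lb2 C z xs) σ) (ee z (X2 xs) σ) (m+1) 0 =
    (∏ j, MM C (z j)) * psi C z xs + ∑ σ, AA C z σ * ((LL C (z (σ (idx m 0))) - 1) *
      Tc (al (la2 C z xs) (lb2 C z xs) σ) (ee z (X2 xs) σ) m 1) := by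
  have w := Wsum C z (X2 xs) (la2 C z xs) (lb2 C z xs) (fun _ _ _ => rfl) (fun _ _ _ => rfl)
    m 0 (fun _ => 1) (by omega) Inv_one (fun σ _ i _ _ => hz _)
  have e : (∏ j, MM C (z j)) * psi C z xs = ∑ σ, AA C z σ * (1 * ∏ i ∈ Finset.range (m+1),
      lb2 C z xs (0+i) (σ (idx m (0+i)))) := by
    unfold psi
    rw [Finset.mul_sum]
    refine Finset.sum_congr rfl (fun σ _ => ?_)
    simp only [zero_add, lb2, one_mul]
    rw [Finset.prod_mul_distrib, prod_idx (fun j => MM C (z j)) σ]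
    ring
  rw [e, ← w, ← Finset.sum_add_distrib]
  refine Finset.sum_congr rfl (fun σ _ => ?_)
  simp only [la2, zero_add]
  ring

lemma off1 (C : ℂ) {m : ℕ} (N : ℕ) (z : Fin (m+1) → ℂ) (xs : ℕ → ℕ) (hz : ∀ j, z j ≠ 1) :
    ∑ σ, AA C z σ * Tc (al (la1 C z xs) (lb1 C N z xs) σ) (ee z xs σ) (m+1) 0 =
    (∏ j, LL C (z j)) * psi C z xs - ∑ σ, AA C z σ * ((LL C (z (σ (idx m m))) - 1) *
      z (σ (idx m m)) ^ N *
      Tc (al (la1 C z xs) (lb1 C N z xs) σ) (ee z xs σ) m 0) := by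
  set lb0 : ℕ → Fin (m+1) → ℂ := fun k j => if k < m then lb1 C N z xs k j else 0 with hlb0
  have w := Asum C z xs (la1 C z xs) lb0
    (fun k j hk => by simp [hlb0, lb1, hk]) (fun _ _ _ => rfl) (fun j => by simp [hlb0])
    (m+1) 0 (fun _ => 1) (by omega) Inv_one (fun σ _ i _ _ => hz _)
  have e : (∏ j, LL C (z j)) * psi C z xs = ∑ σ, AA C z σ * (1 * ∏ i ∈ Finset.range (m+1),
      la1 C z xs (0+i) (σ (idx m (0+i)))) := by
    unfold psi
    rw [Finset.mul_sum]
    refine Finset.sum_congr rfl (fun σ _ => ?_)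
    simp only [zero_add, la1, one_mul]
    rw [Finset.prod_mul_distrib, prod_idx (fun j => LL C (z j)) σ]
    ring
  rw [e, ← w, ← Finset.sum_sub_distrib]
  refine Finset.sum_congr rfl (fun σ _ => ?_)
  rw [Tc_last (al (la1 C z xs) lb0 σ) (al (la1 C z xs) (lb1 C N z xs) σ) (ee z xs σ)
    (- (LL C (z (σ (idx m m))) - 1) * z (σ (idx m m)) ^ N) m 0]
  · rw [Tc_congr (al (la1 C z xs) (lb1 C N z xs) σ) (ee z xs σ) (al (la1 C z xs) lb0 σ)
      (ee z xs σ) m 0 _ (fun _ _ _ => rfl)]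
    · ring
    · intro i _ hi
      simp [al, hlb0, show i < m by omega]
  · intro i _ hi
    simp [al, hlb0, show i < m by omega]
  · simp [al, hlb0, lb1]

lemma rot_idx {m : ℕ} (σ : Equiv.Perm (Fin (m+1))) {k : ℕ} (hk : k < m) :
    (σ * finRotate (m+1)) (idx m k) = σ (idx m (k+1)) := by
  rw [Equiv.Perm.mul_apply]
  congr 1
  have : idx m k = Fin.castSucc ⟨k, hk⟩ := Fin.ext (by rw [idx_val hk.le]; rfl)
  rw [this]
  simp only [finRotate_apply, Fin.coeSucc_eq_succ]
  exact Fin.ext (by rw [idx_val hk]; rfl)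

lemma rot_last {m : ℕ} (σ : Equiv.Perm (Fin (m+1))) :
    (σ * finRotate (m+1)) (idx m m) = σ (idx m 0) := by
  rw [Equiv.Perm.mul_apply]
  congr 1
  have : idx m m = Fin.last m := Fin.ext (by rw [idx_val le_rfl]; rfl)
  rw [this, finRotate_last]
  exact Fin.ext (by rw [idx_val (Nat.zero_le _)]; rfl)

lemma offshell (C : ℂ) {m : ℕ} (N : ℕ) (z : Fin (m+1) → ℂ) (xs : ℕ → ℕ) (hz : ∀ j, z j ≠ 1) :
    ∑ σ, AA C z σ * (Tc (al (la1 C z xs) (lb1 C N z xs) σ) (ee z xs σ) (m+1) 0 +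
       Tc (al (la2 C z xs) (lb2 C z xs) σ) (ee z (X2 xs) σ) (m+1) 0) =
    (∏ j, LL C (z j) + ∏ j, MM C (z j)) * psi C z xs +
    ∑ σ : Equiv.Perm (Fin (m+1)), (LL C (z (σ 0)) - 1) *
      (AA C z σ - AA C z (σ * finRotate (m+1)) * z (σ 0) ^ N) *
      Tc (al (la2 C z xs) (lb2 C z xs) σ) (ee z (X2 xs) σ) m 1 := by
  have h0 : idx m 0 = 0 := Fin.ext (by rw [idx_val (Nat.zero_le _)]; rfl)
  have e1 : ∑ σ, AA C z σ * ((LL C (z (σ (idx m m))) - 1) *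
      z (σ (idx m m)) ^ N *
      Tc (al (la1 C z xs) (lb1 C N z xs) σ) (ee z xs σ) m 0) =
      ∑ σ, AA C z (σ * finRotate (m+1)) * ((LL C (z (σ 0)) - 1) * z (σ 0) ^ N *
      Tc (al (la2 C z xs) (lb2 C z xs) σ) (ee z (X2 xs) σ) m 1) := by
    rw [← Equiv.sum_comp (Equiv.mulRight (finRotate (m+1)))]
    refine Finset.sum_congr rfl (fun σ _ => ?_)
    simp only [Equiv.coe_mulRight, rot_last, h0]
    congr 2
    rw [← Tc_shift]
    apply Tc_congr
    · intro i _ hi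
      have hi' : i < m := by omega
      simp only [al, rot_idx σ hi', la1, lb1, la2, lb2, if_pos hi']
    · intro i _ hi
      simp only [ee, rot_idx σ (show i < m by omega), rot_idx σ (show i + 1 < m by omega), X2]
  simp only [mul_add]
  rw [Finset.sum_add_distrib, off1 C N z xs hz, off2 C z xs hz, e1, h0]
  have e2 : ∑ σ : Equiv.Perm (Fin (m+1)), (LL C (z (σ 0)) - 1) *
      (AA C z σ - AA C z (σ * finRotate (m+1)) * z (σ 0) ^ N) *
      Tc (al (la2 C z xs) (lb2 C z xs) σ) (ee z (X2 xs) σ) m 1 =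
      ∑ σ : Equiv.Perm (Fin (m+1)), AA C z σ * ((LL C (z (σ 0)) - 1) *
      Tc (al (la2 C z xs) (lb2 C z xs) σ) (ee z (X2 xs) σ) m 1) -
      ∑ σ, AA C z (σ * finRotate (m+1)) * ((LL C (z (σ 0)) - 1) * z (σ 0) ^ N *
      Tc (al (la2 C z xs) (lb2 C z xs) σ) (ee z (X2 xs) σ) m 1) := by
    rw [← Finset.sum_sub_distrib]
    refine Finset.sum_congr rfl (fun σ _ => ?_)
    ring
  rw [e2]
  ring

lemma LL_eq (C z : ℂ) (hz : z ≠ 1) : LL C z = ss C z 1 / (1 - z) := by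
  have h1 : (1 - z) ≠ 0 := sub_ne_zero.mpr hz.symm
  unfold LL ss; field_simp; ring

lemma MM_eq (C z : ℂ) (hz : z ≠ 1) : MM C z = - ss C 1 z / (1 - z) := by
  have h1 : (1 - z) ≠ 0 := sub_ne_zero.mpr hz.symm
  unfold MM ss; field_simp; ring

/-- the `Ξ_i` recursion -/
lemma Xi_rec (C : ℂ) {m : ℕ} (z : Fin (m+1) → ℂ) (xs : ℕ → ℕ) (ℓ : Fin (m+1)) (hℓ : z ℓ = 1)
    (hz : ∀ j, j ≠ ℓ → z j ≠ 1) (r : ℕ) : ∀ i, i + r = m →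
    ∑ σ, AA C z σ * ((if σ (idx m i) = ℓ then 1 else 0) *
      (∏ k ∈ Finset.range i, lb2 C z xs k (σ (idx m k))) *
      Tc (al (la2 C z xs) (lb2 C z xs) σ) (ee z (X2 xs) σ) r (i+1)) =
    ∑ t ∈ Finset.range (r+1), ∑ σ, AA C z σ * ((if σ (idx m (i+t)) = ℓ then 1 else 0) *
      ∏ k ∈ Finset.range (m+1), lb2 C z xs k (σ (idx m k))) := by
  have hone : ∀ k, lb2 C z xs k ℓ = 1 := by
    intro k; simp [lb2, MM, hℓ]
  induction r with
  | zero =>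
    intro i hi
    simp only [zero_add, Finset.range_one, Finset.sum_singleton, add_zero]
    refine Finset.sum_congr rfl (fun σ _ => ?_)
    obtain rfl : i = m := by omega
    rw [Finset.prod_range_succ]
    split_ifs with h
    · rw [h, hone]; simp [Tc]
    · simp
  | succ r ih =>
    intro i hi
    rw [Finset.sum_range_succ' _ (r+1)]
    have e2 : ∀ t, i + (t+1) = i + 1 + t := fun t => by omega
    have e3 : ∑ t ∈ Finset.range (r+1), ∑ σ, AA C z σ * ((if σ (idx m (i+(t+1))) = ℓ then 1 else 0) *
      ∏ k ∈ Finset.range (m+1), lb2 C z xs k (σ (idx m k))) =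
      ∑ t ∈ Finset.range (r+1), ∑ σ, AA C z σ * ((if σ (idx m (i+1+t)) = ℓ then 1 else 0) *
      ∏ k ∈ Finset.range (m+1), lb2 C z xs k (σ (idx m k))) :=
      Finset.sum_congr rfl (fun t _ => by rw [e2 t])
    rw [e3, ← ih (i+1) (by omega), add_zero]
    have hinv : Inv (i+1) (fun σ : Equiv.Perm (Fin (m+1)) =>
        ((if σ (idx m i) = ℓ then 1 else 0) : ℂ) *
        (∏ k ∈ Finset.range i, lb2 C z xs k (σ (idx m k)))) := by
      apply Inv.mul
      · exact Inv.pos (fun j => if j = ℓ then 1 else 0) (by omega) (by omega)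
      · intro j hj hjm σ
        refine Finset.prod_congr rfl (fun k hk => ?_)
        rw [Finset.mem_range] at hk
        rw [sw_of_ne σ (show k ≤ m by omega) hjm (by omega) (by omega)]
    have w := Wsum C z (X2 xs) (la2 C z xs) (lb2 C z xs) (fun _ _ _ => rfl) (fun _ _ _ => rfl)
      r (i+1) _ (by omega) hinv (by
        intro σ hσ k hk hkm
        apply hz
        have h1 : σ (idx m i) = ℓ := by
          by_contra h
          simp [h] at hσ
        rw [← h1]
        intro h
        have := idx_inj hkm (show i ≤ m by omega) (σ.injective h)
        omega)
    have e4 : ∑ σ, AA C z σ * ((if σ (idx m i) = ℓ then 1 else 0) *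
      ∏ k ∈ Finset.range (m+1), lb2 C z xs k (σ (idx m k))) =
      ∑ σ, AA C z σ * ((if σ (idx m i) = ℓ then 1 else 0) *
        (∏ k ∈ Finset.range i, lb2 C z xs k (σ (idx m k))) *
        ∏ t ∈ Finset.range (r+1), lb2 C z xs (i+1+t) (σ (idx m (i+1+t)))) := by
      refine Finset.sum_congr rfl (fun σ _ => ?_)
      rw [show Finset.range (m + 1) = Finset.range ((i + 1) + (r + 1)) by congr 1; omega,
        Finset.prod_range_add, Finset.prod_range_succ _ i]
      split_ifs with h
      · rw [h, hone]; ring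
      · simp
    rw [e4, ← w]
    have e5 : ∑ σ, AA C z σ * ((if σ (idx m (i+1)) = ℓ then 1 else 0) *
      (∏ k ∈ Finset.range (i+1), lb2 C z xs k (σ (idx m k))) *
      Tc (al (la2 C z xs) (lb2 C z xs) σ) (ee z (X2 xs) σ) r (i+1+1)) =
      ∑ σ, AA C z σ * ((if σ (idx m i) = ℓ then 1 else 0) *
      (∏ k ∈ Finset.range i, lb2 C z xs k (σ (idx m k))) *
      (la2 C z xs (i+1) (σ (idx m (i+1))) *
      Tc (al (la2 C z xs) (lb2 C z xs) σ) (ee z (X2 xs) σ) r (i+1+1))) := by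
      symm
      rw [← Equiv.sum_comp (Equiv.mulRight (sw m i))]
      refine Finset.sum_congr rfl (fun σ _ => ?_)
      simp only [Equiv.coe_mulRight, sw_left, sw_right]
      rw [Tc_sw z (X2 xs) (la2 C z xs) (lb2 C z xs) σ i r (i+1+1) (by omega) (by omega) (by omega)]
      have e6 : ∏ k ∈ Finset.range i, lb2 C z xs k ((σ * sw m i) (idx m k)) =
          ∏ k ∈ Finset.range i, lb2 C z xs k (σ (idx m k)) := by
        refine Finset.prod_congr rfl (fun k hk => ?_)
        rw [Finset.mem_range] at hk
        rw [sw_of_ne σ (show k ≤ m by omega) (show i < m by omega) (by omega) (by omega)]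
      rw [e6, Finset.prod_range_succ]
      split_ifs with h
      · have hne : z (σ (idx m i)) ≠ 1 := by
          apply hz
          rw [← h]
          intro h'
          have := idx_inj (show i ≤ m by omega) (show i+1 ≤ m by omega) (σ.injective h')
          omega
        have hs := AA_swap C z σ (idx m i) (idx m (i+1))
          (by rw [idx_val (by omega), idx_val (by omega)])
        rw [h, hℓ] at hs
        have hs' : AA C z (σ * sw m i) * LL C (z (σ (idx m i))) =
            AA C z σ * MM C (z (σ (idx m i))) := by
          rw [LL_eq C _ hne, MM_eq C _ hne, ← mul_div_assoc, ← mul_div_assoc]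
          congr 1
          rw [mul_neg]; exact hs
        simp only [la2, lb2]
        linear_combination ((∏ k ∈ Finset.range i, MM C (z (σ (idx m k))) * z (σ (idx m k)) ^ xs k) *
          z (σ (idx m i)) ^ xs i *
          Tc (al (la2 C z xs) (lb2 C z xs) σ) (ee z (X2 xs) σ) r (i+1+1)) * hs'
      · simp
    rw [e5, ← Finset.sum_add_distrib]
    refine Finset.sum_congr rfl (fun σ _ => ?_)
    ring

lemma Xi_final (C : ℂ) {m : ℕ} (z : Fin (m+1) → ℂ) (xs : ℕ → ℕ) (ℓ : Fin (m+1)) (hℓ : z ℓ = 1)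
    (hz : ∀ j, j ≠ ℓ → z j ≠ 1) :
    ∑ σ : Equiv.Perm (Fin (m+1)), AA C z σ * ((if σ 0 = ℓ then 1 else 0) *
      Tc (al (la2 C z xs) (lb2 C z xs) σ) (ee z (X2 xs) σ) m 1) =
    (∏ j, MM C (z j)) * psi C z xs := by
  have h0 : idx m 0 = 0 := Fin.ext (by rw [idx_val (Nat.zero_le _)]; rfl)
  have w := Xi_rec C z xs ℓ hℓ hz m 0 (by omega)
  simp only [Finset.range_zero, Finset.prod_empty, mul_one, zero_add, h0] at w
  rw [w, Finset.sum_comm]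
  unfold psi
  rw [Finset.mul_sum]
  refine Finset.sum_congr rfl (fun σ _ => ?_)
  rw [← Finset.mul_sum, ← Finset.sum_mul]
  have e1 : ∑ t ∈ Finset.range (m+1), (if σ (idx m t) = ℓ then (1:ℂ) else 0) = 1 := by
    rw [← Fin.sum_univ_eq_sum_range (fun t => if σ (idx m t) = ℓ then (1:ℂ) else 0) (m+1)]
    simp only [idx_fin]
    rw [Equiv.sum_comp σ (fun j => if j = ℓ then (1:ℂ) else 0)]
    simp
  rw [e1]
  simp only [lb2]
  rw [Finset.prod_mul_distrib, prod_idx (fun j => MM C (z j)) σ]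
  ring

def ww (C : ℂ) (a b v : ℕ) : ℂ := if v = a ∨ v = b then 1 else if a < v ∧ v < b then C else 0

def pa (C : ℂ) (N a b : ℕ) (z : ℂ) : ℂ := ∑ y : Fin N, ww C a b (y.val+1) * z ^ (y.val+1)

lemma full_sum (C : ℂ) (a b M : ℕ) (hab : a < b) (hb : b < M) (z : ℂ) (hz : z ≠ 1) :
    ∑ v ∈ Finset.range M, ww C a b v * z ^ v = LL C z * z ^ a + MM C z * z ^ b := by
  have h1 : ∀ v, ww C a b v * z ^ v = (if v = a then z ^ v else 0) + (if v = b then z ^ v else 0)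
      + C * (if v ∈ Finset.Ico (a+1) b then z ^ v else 0) := by
    intro v
    simp only [ww, Finset.mem_Ico]
    split_ifs <;> first | omega | simp
  simp only [h1]
  rw [Finset.sum_add_distrib, Finset.sum_add_distrib, ← Finset.mul_sum, Finset.sum_ite_mem,
    Finset.inter_eq_right.mpr (fun v hv => by
      simp only [Finset.mem_Ico] at hv; simp only [Finset.mem_range]; omega),
    geom_sum_Ico hz (by omega), Finset.sum_ite_eq', Finset.sum_ite_eq',
    if_pos (Finset.mem_range.mpr (by omega)), if_pos (Finset.mem_range.mpr (by omega))]
  have h1 : (1 - z) ≠ 0 := sub_ne_zero.mpr hz.symm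
  have h2 : (z - 1) ≠ 0 := sub_ne_zero.mpr hz
  have h3 : (z ^ b - z ^ (a+1)) / (z - 1) = (z ^ (a+1) - z ^ b) / (1 - z) := by
    rw [div_eq_div_iff h2 h1]; ring
  rw [h3]
  unfold LL MM
  field_simp
  ring

lemma pa_eq (C : ℂ) (N a b : ℕ) (hab : a < b) (hb : b ≤ N + 1) (z : ℂ) (hz : z ≠ 1) :
    pa C N a b z = LL C z * z ^ a + MM C z * z ^ b - ww C a b 0
      - ww C a b (N+1) * z ^ (N+1) := by
  rw [← full_sum C a b (N+1+1) hab (by omega) z hz, Finset.sum_range_succ, Finset.sum_range_succ',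
    Finset.sum_range]
  unfold pa
  ring

def Hs (N : ℕ) (g : ℕ → ℕ → ℂ) : ℕ → ℕ → ℕ → ℂ
  | 0, _, _ => 1
  | (r+1), k, v => ∑ y : Fin N, if v < y.val + 1 then g k (y.val+1) * Hs N g r (k+1) (y.val+1) else 0

open scoped Classical in
lemma Hs_sum (N : ℕ) (g : ℕ → ℕ → ℂ) (r : ℕ) : ∀ k v,
    (∑ y : Fin r → Fin N, if StrictMono y ∧ ∀ i, v < (y i).val + 1 then
      ∏ i, g (k + i.val) ((y i).val+1) else 0) = Hs N g r k v := by
  induction r with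
  | zero =>
    intro k v
    have : ∀ y : Fin 0 → Fin N, StrictMono y := fun y i => i.elim0
    simp [Hs, this]
  | succ r ih =>
    intro k v
    rw [← Equiv.sum_comp (Fin.consEquiv (fun _ : Fin (r+1) => Fin N)), Fintype.sum_prod_type]
    simp only [Hs]
    refine Finset.sum_congr rfl (fun a _ => ?_)
    rw [← ih]
    have hc : ∀ f : Fin r → Fin N, (StrictMono (Fin.consEquiv (fun _ : Fin (r+1) => Fin N) (a, f)) ∧
        ∀ i, v < (Fin.consEquiv (fun _ : Fin (r+1) => Fin N) (a, f) i).val + 1) ↔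
        (v < a.val + 1 ∧ (StrictMono f ∧ ∀ i, a.val + 1 < (f i).val + 1)) := by
      intro f
      simp only [Fin.consEquiv_apply]
      constructor
      · rintro ⟨h1, h2⟩
        refine ⟨h2 0, fun i j hij => ?_, fun i => ?_⟩
        · simpa using h1 (Fin.succ_lt_succ_iff.mpr hij)
        · have := h1 (Fin.succ_pos i)
          have : a < f i := this
          have := Fin.lt_def.mp this
          omega
      · rintro ⟨h1, h2, h3⟩
        refine ⟨fun i j => ?_, fun i => ?_⟩
        · refine Fin.cases ?_ (fun i => ?_) i <;> refine Fin.cases ?_ (fun j => ?_) j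
          · intro h; exact absurd h (lt_irrefl _)
          · intro _
            change a < f j
            have := h3 j
            exact Fin.lt_def.mpr (by omega)
          · intro h; exact absurd h (Fin.not_lt_zero _)
          · intro h
            simpa using h2 (Fin.succ_lt_succ_iff.mp h)
        · refine Fin.cases ?_ (fun i => ?_) i
          · exact h1
          · have := h3 i
            change v < (f i).val + 1
            omega
    simp only [hc]
    by_cases hv : v < a.val + 1
    · simp only [hv, true_and, if_true]
      rw [Finset.mul_sum]
      refine Finset.sum_congr rfl (fun f _ => ?_)
      rw [mul_ite, mul_zero]
      congr 1
      rw [Fin.prod_univ_succ]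
      simp only [Fin.consEquiv_apply, Fin.cons_zero, Fin.cons_succ, Fin.val_zero, add_zero,
        Fin.val_succ]
      congr 1
      refine Finset.prod_congr rfl (fun i _ => ?_)
      rw [show k + (i.val + 1) = k + 1 + i.val by omega]
    · simp [hv]

def Tp (α e : ℕ → ℂ) : ℕ → ℕ → ℂ
  | 0, _ => 0
  | (r+1), k => Tc α e r k

lemma Tc_succ (α e : ℕ → ℂ) (r k : ℕ) :
    Tc α e (r+1) k = α k * Tc α e r (k+1) - e k * Tp α e r (k+2) := by
  cases r with
  | zero => simp [Tc, Tp]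
  | succ r => rfl

lemma Hs_Tc (N n : ℕ) (g : ℕ → ℕ → ℂ) (X : ℕ → ℕ)
    (hX : ∀ k, k < n → X k < X (k+1))
    (hXr : ∀ k, 1 ≤ k → k < n → 1 ≤ X k ∧ X k ≤ N)
    (hg : ∀ k y, k < n → g k y ≠ 0 → X k ≤ y ∧ y ≤ X (k+1)) (r : ℕ) :
    let α : ℕ → ℂ := fun k => ∑ y : Fin N, g k (y.val+1)
    let e : ℕ → ℂ := fun k => g k (X (k+1)) * g (k+1) (X (k+1))
    ∀ k, k + r ≤ n → (∀ v, (∀ y, 1 ≤ y → y ≤ v → y < X k) → Hs N g r k v = Tc α e r k) ∧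
      (1 ≤ X k → X k ≤ N → Hs N g r k (X k) = Tc α e r k - g k (X k) * Tp α e r (k+1)) := by
  intro α e
  induction r with
  | zero =>
    intro k _
    simp [Hs, Tc, Tp]
  | succ r ih =>
    intro k hk
    obtain ⟨ih1, ih2⟩ := ih (k+1) (by omega)
    have hXk := hX k (by omega)
    have key : ∀ y, 1 ≤ y → g k y * Hs N g r (k+1) y =
        g k y * Tc α e r (k+1) - (if y = X (k+1) then e k * Tp α e r (k+2) else 0) := by
      intro y hy
      split_ifs with h
      · subst h
        rcases Nat.eq_zero_or_pos r with h0 | h0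
        · subst h0; simp [Hs, Tc, Tp]
        · have := hXr (k+1) (by omega) (by omega)
          rw [ih2 this.1 this.2]
          simp only [e]
          ring
      · by_cases h0 : g k y = 0
        · simp [h0]
        · have := hg k y (by omega) h0
          rw [ih1 y (by intro y' _ _; omega), sub_zero]
    have total : ∑ y : Fin N, g k (y.val+1) * Hs N g r (k+1) (y.val+1) = Tc α e (r+1) k := by
      rw [Tc_succ, Finset.sum_congr rfl (fun y _ => key (y.val+1) (by omega)),
        Finset.sum_sub_distrib, ← Finset.sum_mul]
      congr 1
      rcases Nat.eq_zero_or_pos r with h0 | h0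
      · subst h0; simp [Tp]
      · have hx := hXr (k+1) (by omega) (by omega)
        rw [Finset.sum_eq_single (⟨X (k+1) - 1, by omega⟩ : Fin N)]
        · rw [if_pos]; (try dsimp only); omega
        · intro b _ hb
          rw [if_neg]
          intro h
          apply hb
          ext; (try dsimp only); omega
        · intro h; exact absurd (Finset.mem_univ _) h
    constructor
    · intro v hv
      rw [← total]
      simp only [Hs]
      refine Finset.sum_congr rfl (fun y _ => ?_)
      split_ifs with h
      · rfl
      · have h1 := hv (y.val+1) (by omega) (by omega)
        have h0 : g k (y.val+1) = 0 := by
          by_contra h0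
          have := hg k _ (by omega) h0
          omega
        rw [h0, zero_mul]
    · intro h1 hN
      rw [← total]
      simp only [Hs, Tp]
      rw [eq_sub_iff_add_eq]
      have hs : g k (X k) * Tc α e r (k+1) = ∑ y : Fin N, if y.val + 1 = X k then
          g k (X k) * Tc α e r (k+1) else 0 := by
        rw [Finset.sum_eq_single (⟨X k - 1, by omega⟩ : Fin N)]
        · rw [if_pos]; (try dsimp only); omega
        · intro b _ hb
          rw [if_neg]
          intro h
          apply hb
          ext; (try dsimp only); omega
        · intro h; exact absurd (Finset.mem_univ _) h
      rw [hs, ← Finset.sum_add_distrib]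
      refine Finset.sum_congr rfl (fun y _ => ?_)
      rcases lt_trichotomy (y.val+1) (X k) with h | h | h
      · have h0 : g k (y.val+1) = 0 := by
          by_contra h0
          have := hg k _ (by omega) h0
          omega
        simp [h0, h.ne]
      · rw [if_neg (by omega), if_pos h, h, zero_add, key _ h1, if_neg (by omega), sub_zero]
      · rw [if_pos h, if_neg (by omega), add_zero]

open scoped Classical in
lemma sum_Tc (N n : ℕ) (g : ℕ → ℕ → ℂ) (X : ℕ → ℕ) (α e : ℕ → ℂ)
    (hX : ∀ k, k < n → X k < X (k+1))
    (hXr : ∀ k, 1 ≤ k → k < n → 1 ≤ X k ∧ X k ≤ N)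
    (hg : ∀ k y, k < n → g k y ≠ 0 → X k ≤ y ∧ y ≤ X (k+1))
    (hα : ∀ k, k < n → α k = ∑ y : Fin N, g k (y.val+1))
    (he : ∀ k, k + 1 < n → e k = g k (X (k+1)) * g (k+1) (X (k+1))) :
    (∑ y : Fin n → Fin N, if StrictMono y then ∏ i, g i.val ((y i).val+1) else 0) =
      Tc α e n 0 := by
  have h1 := Hs_sum N g n 0 0
  have h2 := (Hs_Tc N n g X hX hXr hg n 0 (by omega)).1 0 (by intro y h1 h2; omega)
  rw [Tc_congr α e _ _ n 0 (fun i _ hi => hα i (by omega)) (fun i _ hi => he i (by omega)), ← h2,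
    ← h1]
  simp

def xsA {N : ℕ} (m : ℕ) (A : Finset (Fin N)) (h : A.card = m + 1) (k : ℕ) : ℕ :=
  if hk : k < m + 1 then (A.orderEmbOfFin h ⟨k, hk⟩).val + 1 else N + 1

lemma posList_length {N : ℕ} (A : Finset (Fin N)) : (posList A).length = A.card := by
  simp [posList]

lemma posList_getD {N : ℕ} {n : ℕ} (A : Finset (Fin N)) (h : A.card = n) (k : Fin n) :
    (posList A).getD k.val 0 = (A.orderEmbOfFin h k).val + 1 := by
  have hp : posList A = (A.sort (· ≤ ·)).map (fun i : Fin N => i.val + 1) := by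
    unfold posList
    simp only [bind_pure_comp, List.map_eq_map, List.map_map]
    rfl
  have hk : k.val < ((A.sort (· ≤ ·)).map (fun i : Fin N => i.val + 1)).length := by
    rw [← hp, posList_length, h]; exact k.2
  rw [hp, List.getD_eq_getElem _ _ hk]
  rw [List.getElem_map, Finset.orderEmbOfFin_apply]
  rfl

lemma xsA_lt {N m : ℕ} (A : Finset (Fin N)) (h : A.card = m + 1) (k : ℕ) (hk : k < m + 1) :
    xsA m A h k < xsA m A h (k+1) := by
  unfold xsA
  rw [dif_pos hk]
  split_ifs with h'
  · have : A.orderEmbOfFin h ⟨k, hk⟩ < A.orderEmbOfFin h ⟨k+1, h'⟩ := by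
      apply (A.orderEmbOfFin h).strictMono
      exact Fin.lt_def.mpr (by simp)
    have := Fin.lt_def.mp this
    omega
  · have := (A.orderEmbOfFin h ⟨k, hk⟩).2
    omega

lemma xsA_range {N m : ℕ} (A : Finset (Fin N)) (h : A.card = m + 1) (k : ℕ) (hk : k < m + 1) :
    1 ≤ xsA m A h k ∧ xsA m A h k ≤ N := by
  unfold xsA
  rw [dif_pos hk]
  have := (A.orderEmbOfFin h ⟨k, hk⟩).2
  omega

lemma mem_A {N m : ℕ} (A : Finset (Fin N)) (h : A.card = m + 1) (y : Fin N) :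
    y ∈ A ↔ ∃ k, k < m + 1 ∧ y.val + 1 = xsA m A h k := by
  rw [← Finset.mem_coe, ← Finset.range_orderEmbOfFin A h, Set.mem_range]
  constructor
  · rintro ⟨k, rfl⟩
    refine ⟨k.val, k.2, ?_⟩
    rw [xsA, dif_pos k.2]
  · rintro ⟨k, hk, e⟩
    refine ⟨⟨k, hk⟩, ?_⟩
    simp only [xsA, hk, dif_pos] at e
    exact Fin.ext (by omega)

/-- the product formula for one interlacing type -/
lemma prod_ww {N m : ℕ} (c : ℂ) (A : Finset (Fin N)) (X : ℕ → ℕ)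
    (y : Fin (m+1) → Fin N) (hX : ∀ k, k < m + 1 → X k ≤ X (k+1))
    (hm : ∀ k : Fin (m+1), X k.val ≤ (y k).val + 1 → (y k).val + 1 ≤ X (k.val + 1) →
      ((y k).val + 1 = X k.val ∨ (y k).val + 1 = X (k.val + 1) ↔ y k ∈ A)) [Decidable (∀ k : Fin (m+1), X k.val ≤ (y k).val + 1 ∧ (y k).val + 1 ≤ X (k.val + 1))] :
    ∏ k : Fin (m+1), ww (c^2) (X k.val) (X (k.val+1)) ((y k).val+1) =
      if ∀ k : Fin (m+1), X k.val ≤ (y k).val + 1 ∧ (y k).val + 1 ≤ X (k.val + 1) then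
        c ^ (2 * (Finset.univ.filter (fun k => y k ∉ A)).card) else 0 := by
  split_ifs with h
  · rw [pow_mul, ← Finset.prod_const, Finset.prod_filter]
    refine Finset.prod_congr rfl (fun k _ => ?_)
    have hk := hm k (h k).1 (h k).2
    unfold ww
    by_cases hA : y k ∈ A
    · rw [if_pos (hk.mpr hA), if_neg (by simpa using hA)]
    · have h' := mt hk.mp hA
      rw [if_neg h', if_pos (by have := h k; omega), if_pos hA]
  · push Not at h
    obtain ⟨k, hk⟩ := h
    apply Finset.prod_eq_zero (Finset.mem_univ k)
    unfold ww
    rw [if_neg, if_neg]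
    · rintro ⟨h1, h2⟩; have := hk (by omega); omega
    · have hh : ¬ (X k.val ≤ (y k).val + 1 ∧ (y k).val + 1 ≤ X (k.val + 1)) := by
        rintro ⟨h1, h2⟩; have := hk h1; omega
      have := hX k.val k.2
      omega

lemma Pdiff_eq {N m : ℕ} (A : Finset (Fin N)) (h : A.card = m + 1) (y : Fin (m+1) → Fin N)
    (hy : StrictMono y) :
    Pdiff A (Finset.univ.image y) = 2 * (Finset.univ.filter (fun k => y k ∉ A)).card := by
  have hB : (Finset.univ.image y).card = m + 1 := by
    rw [Finset.card_image_of_injective _ hy.injective]; simp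
  have h1 : (Finset.univ.image y \ A).card = (Finset.univ.filter (fun k => y k ∉ A)).card := by
    rw [← Finset.card_image_of_injective _ hy.injective]
    congr 1
    ext v
    simp only [Finset.mem_sdiff, Finset.mem_image, Finset.mem_univ, true_and, Finset.mem_filter]
    constructor
    · rintro ⟨⟨k, rfl⟩, hv⟩; exact ⟨k, hv, rfl⟩
    · rintro ⟨k, hv, rfl⟩; exact ⟨⟨k, rfl⟩, hv⟩
  have h2 : (A \ Finset.univ.image y).card = (Finset.univ.image y \ A).card :=
    Finset.card_sdiff_comm (h.trans hB.symm)
  unfold Pdiff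
  rw [symmDiff_def, Finset.sup_eq_union, Finset.card_union_of_disjoint disjoint_sdiff_sdiff, h2, h1]
  ring

lemma emb_image {N n : ℕ} (y : Fin n → Fin N) (hy : StrictMono y)
    (hB : (Finset.univ.image y).card = n) (k : Fin n) :
    (Finset.univ.image y).orderEmbOfFin hB k = y k := by
  have := Finset.orderEmbOfFin_unique hB (f := y) (fun x => by simp) hy
  exact (congrFun this k).symm

lemma V_prod {N m : ℕ} (c : ℝ) (A : Finset (Fin N)) (h : A.card = m + 1) (y : Fin (m+1) → Fin N)
    (hy : StrictMono y) :
    transferV N c A (Finset.univ.image y) =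
      ∏ k : Fin (m+1), ww ((c:ℂ)^2) (xsA m A h k.val) (xsA m A h (k.val+1)) ((y k).val+1) +
      ∏ k : Fin (m+1), ww ((c:ℂ)^2) (X2 (xsA m A h) k.val) (X2 (xsA m A h) (k.val+1))
        ((y k).val+1) := by
  classical
  have hB : (Finset.univ.image y).card = m + 1 := by
    rw [Finset.card_image_of_injective _ hy.injective]; simp
  set xs := xsA m A h with hxs
  have hlt : ∀ k, k < m + 1 → xs k < xs (k+1) := xsA_lt A h
  have hmono : ∀ j k, j < k → k ≤ m + 1 → xs j < xs k := by
    intro j k hjk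
    induction k with
    | zero => omega
    | succ k ih =>
      intro hk
      have := hlt k (by omega)
      rcases Nat.lt_or_ge j k with h' | h'
      · have := ih h' (by omega); omega
      · obtain rfl : j = k := by omega
        exact this
  have hlast : xs (m+1) = N + 1 := by simp [hxs, xsA]
  have hA : ∀ k : Fin (m+1), (posList A).getD k.val 0 = xs k.val := by
    intro k; rw [posList_getD A h, hxs, xsA, dif_pos k.2]
  have hBp : ∀ k : Fin (m+1), (posList (Finset.univ.image y)).getD k.val 0 = (y k).val + 1 := by
    intro k; rw [posList_getD _ hB, emb_image y hy hB]
  have i1 : seqInterlace (posList A) (posList (Finset.univ.image y)) ↔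
      ∀ k : Fin (m+1), xs k.val ≤ (y k).val + 1 ∧ (y k).val + 1 ≤ xs (k.val+1) := by
    unfold seqInterlace
    rw [posList_length, h]
    constructor
    · intro H k
      have := H k.val k.2
      rw [hA, hBp] at this
      refine ⟨this.1, ?_⟩
      rcases Nat.lt_or_ge (k.val+1) (m+1) with h' | h'
      · have h2 := this.2 h'
        rwa [hA ⟨k.val+1, h'⟩] at h2
      · have : k.val + 1 = m + 1 := by omega
        rw [this, hlast]
        have := (y k).2
        omega
    · intro H i hi
      have := H ⟨i, hi⟩
      rw [hA ⟨i, hi⟩, hBp ⟨i, hi⟩]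
      refine ⟨this.1, fun h' => ?_⟩
      rw [hA ⟨i+1, h'⟩]
      exact this.2
  have i2 : seqInterlace (posList (Finset.univ.image y)) (posList A) ↔
      ∀ k : Fin (m+1), X2 xs k.val ≤ (y k).val + 1 ∧ (y k).val + 1 ≤ X2 xs (k.val+1) := by
    unfold seqInterlace
    rw [posList_length, hB]
    constructor
    · intro H k
      have := H k.val k.2
      rw [hA, hBp] at this
      refine ⟨?_, this.1⟩
      obtain ⟨k, hk⟩ := k
      cases k with
      | zero => simp [X2]
      | succ k =>
        have h2 := (H k (by omega)).2 hk
        rw [hA ⟨k, by omega⟩, hBp ⟨k+1, hk⟩] at h2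
        exact h2
    · intro H i hi
      have := H ⟨i, hi⟩
      rw [hA ⟨i, hi⟩, hBp ⟨i, hi⟩]
      refine ⟨this.2, fun h' => ?_⟩
      rw [hBp ⟨i+1, h'⟩]
      exact (H ⟨i+1, h'⟩).1
  have m1 : ∀ k : Fin (m+1), xs k.val ≤ (y k).val + 1 → (y k).val + 1 ≤ xs (k.val + 1) →
      ((y k).val + 1 = xs k.val ∨ (y k).val + 1 = xs (k.val + 1) ↔ y k ∈ A) := by
    intro k h1 h2
    rw [mem_A A h]
    constructor
    · rintro (h3 | h3)
      · exact ⟨k.val, k.2, h3⟩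
      · refine ⟨k.val + 1, ?_, h3⟩
        by_contra hc
        have e : k.val + 1 = m + 1 := by omega
        rw [e, hlast] at h3
        have := (y k).2
        omega
    · rintro ⟨j, hj, e⟩
      rw [← hxs] at e
      rcases lt_trichotomy j k.val with h3 | h3 | h3
      · have := hmono j k.val h3 (by omega); omega
      · left; rw [e, h3]
      · rcases Nat.lt_or_ge (k.val+1) j with h4 | h4
        · have := hmono (k.val+1) j h4 (by omega); omega
        · right; rw [e]; congr 1; omega
  have m2 : ∀ k : Fin (m+1), X2 xs k.val ≤ (y k).val + 1 → (y k).val + 1 ≤ X2 xs (k.val + 1) →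
      ((y k).val + 1 = X2 xs k.val ∨ (y k).val + 1 = X2 xs (k.val + 1) ↔ y k ∈ A) := by
    rintro ⟨k, hk⟩ h1 h2
    rw [mem_A A h]
    cases k with
    | zero =>
      simp only [X2] at h1 h2 ⊢
      constructor
      · rintro (h3 | h3)
        · omega
        · exact ⟨0, by omega, h3⟩
      · rintro ⟨j, hj, e⟩
        rw [← hxs] at e
        rcases Nat.eq_zero_or_pos j with h3 | h3
        · right; rw [e, h3]
        · have := hmono 0 j h3 (by omega)
          omega
    | succ k =>
      simp only [X2] at h1 h2 ⊢
      constructor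
      · rintro (h3 | h3)
        · exact ⟨k, by omega, h3⟩
        · exact ⟨k+1, hk, h3⟩
      · rintro ⟨j, hj, e⟩
        rw [← hxs] at e
        rcases lt_trichotomy j k with h3 | h3 | h3
        · have := hmono j k h3 (by omega); omega
        · left; rw [e, h3]
        · rcases Nat.lt_or_ge (k+1) j with h4 | h4
          · have := hmono (k+1) j h4 (by omega); omega
          · right; rw [e]; congr 1; omega
  rw [prod_ww (c:ℂ) A xs y (fun k hk => (hlt k hk).le) m1, prod_ww (c:ℂ) A (X2 xs) y (fun k hk => by
      cases k with
      | zero => simp [X2]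
      | succ k => exact (hlt k (by omega)).le) m2, ← Pdiff_eq A h y hy]
  simp only [← i1, ← i2]
  unfold transferV
  simp only [Matrix.of_apply]
  by_cases hAB : A = Finset.univ.image y
  · have hs : seqInterlace (posList A) (posList A) := by
      intro i hi
      rw [posList_length, h] at hi
      refine ⟨le_rfl, fun hi' => ?_⟩
      rw [posList_length, h] at hi'
      rw [hA ⟨i, hi⟩, hA ⟨i+1, hi'⟩]
      exact (hlt i hi).le
    rw [if_pos hAB, ← hAB, if_pos hs]
    simp [Pdiff]
    norm_num
  · rw [if_neg hAB]
    have hnot : ¬ (seqInterlace (posList A) (posList (Finset.univ.image y)) ∧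
        seqInterlace (posList (Finset.univ.image y)) (posList A)) := by
      rintro ⟨s1, s2⟩
      apply hAB
      have r1 := i1.mp s1
      have r2 := i2.mp s2
      have hx : ∀ k : Fin (m+1), (y k).val + 1 = xs k.val := fun k =>
        le_antisymm (r2 k).2 (r1 k).1
      ext v
      rw [mem_A A h]
      simp only [Finset.mem_image, Finset.mem_univ, true_and]
      constructor
      · rintro ⟨k, hk, e⟩
        rw [← hxs] at e
        exact ⟨⟨k, hk⟩, Fin.ext (by have := hx ⟨k, hk⟩; simp only at this; omega)⟩
      · rintro ⟨k, rfl⟩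
        exact ⟨k.val, k.2, hx k⟩
    have hI : Interlaced A (Finset.univ.image y) ↔
        (seqInterlace (posList A) (posList (Finset.univ.image y)) ∨
        seqInterlace (posList (Finset.univ.image y)) (posList A)) := by
      unfold Interlaced
      rw [h, hB]; simp
    by_cases s1 : seqInterlace (posList A) (posList (Finset.univ.image y))
    · have s2 : ¬ seqInterlace (posList (Finset.univ.image y)) (posList A) :=
        fun s2 => hnot ⟨s1, s2⟩
      rw [if_pos (hI.mpr (Or.inl s1)), if_pos s1, if_neg s2, add_zero]
    · by_cases s2 : seqInterlace (posList (Finset.univ.image y)) (posList A)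
      · rw [if_pos (hI.mpr (Or.inr s2)), if_neg s1, if_pos s2, zero_add]
      · rw [if_neg (fun hh => (hI.mp hh).elim s1 s2), if_neg s1, if_neg s2, add_zero]

open scoped Classical in
lemma sum_finset_eq {N n : ℕ} (f : Finset (Fin N) → ℂ) (hf : ∀ B, B.card ≠ n → f B = 0) :
    ∑ B, f B = ∑ y : Fin n → Fin N, if StrictMono y then f (Finset.univ.image y) else 0 := by
  rw [← Finset.sum_filter]
  symm
  apply Finset.sum_of_injOn (fun y => Finset.univ.image y)
  · intro y hy y' hy' e
    simp only [Finset.coe_filter, Finset.mem_univ, true_and, Set.mem_ofPred_eq] at hy hy'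
    have e' : Set.range y = Set.range y' := by
      have := congrArg (fun s : Finset (Fin N) => (s : Set (Fin N))) e
      simpa using this
    exact (StrictMono.range_inj hy hy').mp e'
  · intro y _; simp
  · intro B _ hB
    by_contra h0
    have hc : B.card = n := by
      by_contra hc; exact h0 (hf B hc)
    apply hB
    refine ⟨B.orderEmbOfFin hc, ?_, ?_⟩
    · simp [(B.orderEmbOfFin hc).strictMono]
    · simp
  · intro y _; rfl

def psiB (C : ℂ) {N : ℕ} (m : ℕ) (z : Fin (m+1) → ℂ) (B : Finset (Fin N)) : ℂ :=
  if h : B.card = m + 1 then psi C z (xsA m B h) else 0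

def ap (C : ℂ) (N : ℕ) {m : ℕ} (z : Fin (m+1) → ℂ) (X : ℕ → ℕ) (σ : Equiv.Perm (Fin (m+1)))
    (k : ℕ) : ℂ := pa C N (X k) (X (k+1)) (z (σ (idx m k)))

lemma psiB_image (C : ℂ) {N m : ℕ} (z : Fin (m+1) → ℂ) (y : Fin (m+1) → Fin N)
    (hy : StrictMono y) :
    psiB C m z (Finset.univ.image y) =
      ∑ σ, AA C z σ * ∏ k : Fin (m+1), z (σ (idx m k.val)) ^ ((y k).val + 1) := by
  have hB : (Finset.univ.image y).card = m + 1 := by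
    rw [Finset.card_image_of_injective _ hy.injective]; simp
  rw [psiB, dif_pos hB, psi]
  refine Finset.sum_congr rfl (fun σ _ => ?_)
  congr 1
  rw [← Fin.prod_univ_eq_prod_range (fun i => z (σ (idx m i)) ^ xsA m (Finset.univ.image y) hB i)]
  refine Finset.prod_congr rfl (fun k _ => ?_)
  rw [xsA, dif_pos k.2, emb_image y hy hB]

open scoped Classical in
lemma sum_ap (C : ℂ) {N m : ℕ} (z : Fin (m+1) → ℂ) (X : ℕ → ℕ) (σ : Equiv.Perm (Fin (m+1)))
    (hX : ∀ k, k < m + 1 → X k < X (k+1))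
    (hXr : ∀ k, 1 ≤ k → k < m + 1 → 1 ≤ X k ∧ X k ≤ N) :
    (∑ y : Fin (m+1) → Fin N, if StrictMono y then
      (∏ k : Fin (m+1), ww C (X k.val) (X (k.val+1)) ((y k).val+1)) *
      ∏ k : Fin (m+1), z (σ (idx m k.val)) ^ ((y k).val + 1) else 0) =
    Tc (ap C N z X σ) (ee z X σ) (m+1) 0 := by
  rw [← sum_Tc N (m+1) (fun k v => ww C (X k) (X (k+1)) v * z (σ (idx m k)) ^ v) X
    (ap C N z X σ) (ee z X σ) hX hXr ?_ ?_ ?_]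
  · refine Finset.sum_congr rfl (fun y _ => ?_)
    simp only [Finset.prod_mul_distrib]
  · intro k y hk hne
    have h0 : ww C (X k) (X (k+1)) y ≠ 0 := left_ne_zero_of_mul hne
    have := hX k hk
    by_contra hcon
    apply h0
    unfold ww
    rw [if_neg (by omega), if_neg (by omega)]
  · intro k _; rfl
  · intro k _
    have w1 : ww C (X k) (X (k+1)) (X (k+1)) = 1 := by simp [ww]
    have w2 : ww C (X (k+1)) (X (k+1+1)) (X (k+1)) = 1 := by simp [ww]
    simp only [w1, w2, one_mul, ee, mul_pow]

lemma X2_lt {N m : ℕ} (A : Finset (Fin N)) (h : A.card = m + 1) (k : ℕ) (hk : k < m + 1) :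
    X2 (xsA m A h) k < X2 (xsA m A h) (k+1) := by
  cases k with
  | zero => exact (xsA_range A h 0 hk).1
  | succ k => exact xsA_lt A h k (by omega)

lemma X2_range {N m : ℕ} (A : Finset (Fin N)) (h : A.card = m + 1) (k : ℕ) (h1 : 1 ≤ k)
    (hk : k < m + 1 + 1) : 1 ≤ X2 (xsA m A h) k ∧ X2 (xsA m A h) k ≤ N := by
  cases k with
  | zero => omega
  | succ k => exact xsA_range A h k (by omega)

lemma V_sum (c : ℝ) {N m : ℕ} (A : Finset (Fin N)) (h : A.card = m + 1) (z : Fin (m+1) → ℂ) :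
    ∑ B, transferV N c A B * psiB ((c:ℂ)^2) m z B =
      ∑ σ, AA ((c:ℂ)^2) z σ *
        (Tc (ap ((c:ℂ)^2) N z (xsA m A h) σ) (ee z (xsA m A h) σ) (m+1) 0 +
         Tc (ap ((c:ℂ)^2) N z (X2 (xsA m A h)) σ) (ee z (X2 (xsA m A h)) σ) (m+1) 0) := by
  classical
  rw [sum_finset_eq (n := m+1) _ (fun B hB => by rw [psiB, dif_neg hB, mul_zero])]
  have e1 : ∀ y : Fin (m+1) → Fin N, (if StrictMono y then transferV N c A (Finset.univ.image y) *
      psiB ((c:ℂ)^2) m z (Finset.univ.image y) else 0) =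
      ∑ σ, AA ((c:ℂ)^2) z σ * ((if StrictMono y then
      (∏ k : Fin (m+1), ww ((c:ℂ)^2) (xsA m A h k.val) (xsA m A h (k.val+1)) ((y k).val+1)) *
      ∏ k : Fin (m+1), z (σ (idx m k.val)) ^ ((y k).val + 1) else 0) +
      (if StrictMono y then
      (∏ k : Fin (m+1), ww ((c:ℂ)^2) (X2 (xsA m A h) k.val) (X2 (xsA m A h) (k.val+1)) ((y k).val+1)) *
      ∏ k : Fin (m+1), z (σ (idx m k.val)) ^ ((y k).val + 1) else 0)) := by
    intro y
    by_cases hy : StrictMono y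
    · simp only [hy, if_true]
      rw [V_prod c A h y hy, psiB_image _ z y hy, Finset.mul_sum]
      refine Finset.sum_congr rfl (fun σ _ => ?_)
      ring
    · simp [hy]
  rw [Finset.sum_congr rfl (fun y _ => e1 y), Finset.sum_comm]
  refine Finset.sum_congr rfl (fun σ _ => ?_)
  rw [← Finset.mul_sum, Finset.sum_add_distrib]
  rw [sum_ap _ z (xsA m A h) σ (xsA_lt A h) (fun k _ hk => xsA_range A h k hk),
    sum_ap _ z (X2 (xsA m A h)) σ (X2_lt A h) (fun k h1 hk => X2_range A h k h1 (by omega))]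

lemma ap1_eq (C : ℂ) {N m : ℕ} (A : Finset (Fin N)) (h : A.card = m + 1) (z : Fin (m+1) → ℂ)
    (σ : Equiv.Perm (Fin (m+1))) (k : ℕ) (hk : k < m + 1) (hz : z (σ (idx m k)) ≠ 1) :
    ap C N z (xsA m A h) σ k = al (la1 C z (xsA m A h)) (lb1 C N z (xsA m A h)) σ k := by
  have h1 := xsA_lt A h k hk
  have h2 := xsA_range A h k hk
  unfold ap
  rcases Nat.lt_or_ge k m with hkm | hkm
  · have h3 := xsA_range A h (k+1) (by omega)
    rw [pa_eq C N _ _ h1 (by omega) _ hz]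
    have w1 : ww C (xsA m A h k) (xsA m A h (k+1)) 0 = 0 := by
      unfold ww; rw [if_neg (by omega), if_neg (by omega)]
    have w2 : ww C (xsA m A h k) (xsA m A h (k+1)) (N+1) = 0 := by
      unfold ww; rw [if_neg (by omega), if_neg (by omega)]
    rw [w1, w2, al, la1, lb1, if_pos hkm]
    ring
  · have h3 : xsA m A h (k+1) = N + 1 := by rw [xsA, dif_neg (by omega)]
    rw [pa_eq C N _ _ h1 (by omega) _ hz]
    have w1 : ww C (xsA m A h k) (xsA m A h (k+1)) 0 = 0 := by
      unfold ww; rw [if_neg (by omega), if_neg (by omega)]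
    have w2 : ww C (xsA m A h k) (xsA m A h (k+1)) (N+1) = 1 := by
      unfold ww; rw [if_pos (by omega)]
    rw [w1, w2, al, la1, lb1, if_neg (by omega), h3]
    have h1 : (1 - z (σ (idx m k))) ≠ 0 := sub_ne_zero.mpr hz.symm
    unfold LL MM
    field_simp
    ring

lemma ap2_eq (C : ℂ) {N m : ℕ} (A : Finset (Fin N)) (h : A.card = m + 1) (z : Fin (m+1) → ℂ)
    (σ : Equiv.Perm (Fin (m+1))) (k : ℕ) (hk : k < m + 1) (hz : z (σ (idx m k)) ≠ 1) :
    ap C N z (X2 (xsA m A h)) σ k = al (la2 C z (xsA m A h)) (lb2 C z (xsA m A h)) σ k := by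
  have h1 := X2_lt A h k hk
  have h3 := X2_range A h (k+1) (by omega) (by omega)
  unfold ap
  rw [pa_eq C N _ _ h1 (by omega) _ hz]
  have w2 : ww C (X2 (xsA m A h) k) (X2 (xsA m A h) (k+1)) (N+1) = 0 := by
    unfold ww; rw [if_neg (by omega), if_neg (by omega)]
  rw [w2]
  cases k with
  | zero =>
    have w1 : ww C (X2 (xsA m A h) 0) (X2 (xsA m A h) (0+1)) 0 = 1 := by
      simp [ww, X2]
    rw [w1, al, la2, lb2]
    simp only [X2]
    ring
  | succ k =>
    have h2 := X2_range A h (k+1) (by omega) (by omega)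
    have w1 : ww C (X2 (xsA m A h) (k+1)) (X2 (xsA m A h) (k+1+1)) 0 = 0 := by
      unfold ww; rw [if_neg (by omega), if_neg (by omega)]
    rw [w1, al, la2, lb2]
    simp only [X2]
    ring

/-- off-shell formula with polynomial continuants -/
lemma offshell' (c : ℝ) {N m : ℕ} (A : Finset (Fin N)) (h : A.card = m + 1) (z : Fin (m+1) → ℂ)
    (hz : ∀ j, z j ≠ 1) :
    ∑ B, transferV N c A B * psiB ((c:ℂ)^2) m z B =
    (∏ j, LL ((c:ℂ)^2) (z j) + ∏ j, MM ((c:ℂ)^2) (z j)) * psiB ((c:ℂ)^2) m z A +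
    ∑ σ : Equiv.Perm (Fin (m+1)), (LL ((c:ℂ)^2) (z (σ 0)) - 1) *
      (AA ((c:ℂ)^2) z σ - AA ((c:ℂ)^2) z (σ * finRotate (m+1)) * z (σ 0) ^ N) *
      Tc (ap ((c:ℂ)^2) N z (X2 (xsA m A h)) σ) (ee z (X2 (xsA m A h)) σ) m 1 := by
  have hoff := offshell ((c:ℂ)^2) N z (xsA m A h) hz
  rw [V_sum c A h z, psiB, dif_pos h]
  have e1 : ∀ σ : Equiv.Perm (Fin (m+1)),
      Tc (ap ((c:ℂ)^2) N z (xsA m A h) σ) (ee z (xsA m A h) σ) (m+1) 0 =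
      Tc (al (la1 ((c:ℂ)^2) z (xsA m A h)) (lb1 ((c:ℂ)^2) N z (xsA m A h)) σ)
        (ee z (xsA m A h) σ) (m+1) 0 := fun σ => Tc_congr _ _ _ _ _ _
      (fun i _ hi => ap1_eq _ A h z σ i (by omega) (hz _)) (fun _ _ _ => rfl)
  have e2 : ∀ (σ : Equiv.Perm (Fin (m+1))),
      Tc (ap ((c:ℂ)^2) N z (X2 (xsA m A h)) σ) (ee z (X2 (xsA m A h)) σ) (m+1) 0 =
      Tc (al (la2 ((c:ℂ)^2) z (xsA m A h)) (lb2 ((c:ℂ)^2) z (xsA m A h)) σ)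
        (ee z (X2 (xsA m A h)) σ) (m+1) 0 := fun σ => Tc_congr _ _ _ _ _ _
      (fun i _ hi => ap2_eq _ A h z σ i (by omega) (hz _)) (fun _ _ _ => rfl)
  have e3 : ∀ (σ : Equiv.Perm (Fin (m+1))),
      Tc (ap ((c:ℂ)^2) N z (X2 (xsA m A h)) σ) (ee z (X2 (xsA m A h)) σ) m 1 =
      Tc (al (la2 ((c:ℂ)^2) z (xsA m A h)) (lb2 ((c:ℂ)^2) z (xsA m A h)) σ)
        (ee z (X2 (xsA m A h)) σ) m 1 := fun σ => Tc_congr _ _ _ _ _ _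
      (fun i _ hi => ap2_eq _ A h z σ i (by omega) (hz _)) (fun _ _ _ => rfl)
  simp only [e1, e2, e3]
  exact hoff

lemma Xi_final' (C : ℂ) {N m : ℕ} (A : Finset (Fin N)) (h : A.card = m + 1) (z : Fin (m+1) → ℂ)
    (ℓ : Fin (m+1)) (hℓ : z ℓ = 1) (hz : ∀ j, j ≠ ℓ → z j ≠ 1) :
    ∑ σ : Equiv.Perm (Fin (m+1)), AA C z σ * ((if σ 0 = ℓ then 1 else 0) *
      Tc (ap C N z (X2 (xsA m A h)) σ) (ee z (X2 (xsA m A h)) σ) m 1) =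
    (∏ j ∈ Finset.univ.erase ℓ, MM C (z j)) * psiB C m z A := by
  have hX := Xi_final C z (xsA m A h) ℓ hℓ hz
  rw [← Finset.mul_prod_erase Finset.univ _ (Finset.mem_univ ℓ), hℓ] at hX
  have hM : MM C 1 = 1 := by simp [MM]
  rw [hM, one_mul] at hX
  rw [psiB, dif_pos h, ← hX]
  refine Finset.sum_congr rfl (fun σ _ => ?_)
  congr 1
  split_ifs with hσ
  · congr 1
    refine Tc_congr _ _ _ _ _ _ (fun i h1 hi => ap2_eq _ A h z σ i (by omega) (hz _ ?_))
      (fun _ _ _ => rfl)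
    intro he
    rw [← hσ] at he
    have h2 := congrArg Fin.val (σ.injective he)
    rw [idx_val (by omega)] at h2
    simp only [Fin.val_zero] at h2
    omega
  · simp

open Filter Topology

def zu {m : ℕ} (z : Fin (m+1) → ℂ) (ℓ : Fin (m+1)) (u : ℝ) : Fin (m+1) → ℂ :=
  Function.update z ℓ (Complex.exp (Complex.I * (u : ℂ)))

lemma AA_tendsto (C : ℂ) {m : ℕ} (l : Filter ℝ) (Z : ℝ → Fin (m+1) → ℂ) (z : Fin (m+1) → ℂ)
    (hZ : ∀ j, Tendsto (fun u => Z u j) l (𝓝 (z j))) (σ : Equiv.Perm (Fin (m+1))) :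
    Tendsto (fun u => AA C (Z u) σ) l (𝓝 (AA C z σ)) := by
  unfold AA
  refine Tendsto.const_mul _ (tendsto_finsetProd _ (fun kl _ => ?_))
  unfold ss
  exact ((tendsto_const_nhds.add ((hZ _).mul (hZ _)))).sub ((hZ _).const_mul _)

lemma psiB_tendsto (C : ℂ) {N m : ℕ} (l : Filter ℝ) (Z : ℝ → Fin (m+1) → ℂ) (z : Fin (m+1) → ℂ)
    (hZ : ∀ j, Tendsto (fun u => Z u j) l (𝓝 (z j))) (B : Finset (Fin N)) :
    Tendsto (fun u => psiB C m (Z u) B) l (𝓝 (psiB C m z B)) := by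
  unfold psiB
  split_ifs with h
  · unfold psi
    refine tendsto_finsetSum _ (fun σ _ => (AA_tendsto C l Z z hZ σ).mul ?_)
    exact tendsto_finsetProd _ (fun i _ => (hZ _).pow _)
  · exact tendsto_const_nhds

lemma TT_tendsto (C : ℂ) {N m : ℕ} (l : Filter ℝ) (Z : ℝ → Fin (m+1) → ℂ) (z : Fin (m+1) → ℂ)
    (hZ : ∀ j, Tendsto (fun u => Z u j) l (𝓝 (z j))) (X : ℕ → ℕ) (σ : Equiv.Perm (Fin (m+1)))
    (r k : ℕ) :
    Tendsto (fun u => Tc (ap C N (Z u) X σ) (ee (Z u) X σ) r k) l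
      (𝓝 (Tc (ap C N z X σ) (ee z X σ) r k)) := by
  apply Tc_tendsto
  · intro i
    unfold ap pa
    exact tendsto_finsetSum _ (fun y _ => ((hZ _).pow _).const_mul _)
  · intro i
    unfold ee
    exact ((hZ _).mul (hZ _)).pow _

lemma limit_thm (c : ℝ) {N m : ℕ} (A : Finset (Fin N)) (h : A.card = m + 1) (z : Fin (m+1) → ℂ)
    (ℓ : Fin (m+1)) (hℓ : z ℓ = 1) (hz : ∀ j, j ≠ ℓ → z j ≠ 1) (D : ℂ) (R : ℝ → ℂ)
    (hprod : ∏ j ∈ Finset.univ.erase ℓ, LL ((c:ℂ)^2) (z j) =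
      ∏ j ∈ Finset.univ.erase ℓ, MM ((c:ℂ)^2) (z j))
    (hBE : ∀ σ : Equiv.Perm (Fin (m+1)), σ 0 ≠ ℓ →
      AA ((c:ℂ)^2) z (σ * finRotate (m+1)) * z (σ 0) ^ N = AA ((c:ℂ)^2) z σ)
    (hne : ∀ᶠ u : ℝ in 𝓝[≠] 0, Complex.exp (Complex.I * (u : ℂ)) ≠ 1)
    (hR : ∀ᶠ u : ℝ in 𝓝[≠] 0, ∀ σ : Equiv.Perm (Fin (m+1)), σ 0 = ℓ →
      AA ((c:ℂ)^2) (zu z ℓ u) (σ * finRotate (m+1)) * zu z ℓ u (σ 0) ^ N =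
        AA ((c:ℂ)^2) (zu z ℓ u) σ * R u)
    (hlim : Tendsto (fun u : ℝ => (LL ((c:ℂ)^2) (Complex.exp (Complex.I * (u : ℂ))) - 1) *
      (1 - R u)) (𝓝[≠] 0) (𝓝 D)) :
    ∑ B, transferV N c A B * psiB ((c:ℂ)^2) m z B =
      ((2 - (c:ℂ)^2 + D) * ∏ j ∈ Finset.univ.erase ℓ, MM ((c:ℂ)^2) (z j)) *
        psiB ((c:ℂ)^2) m z A := by
  set C : ℂ := (c:ℂ)^2 with hC
  have hZ0 : Tendsto (fun u : ℝ => Complex.exp (Complex.I * (u : ℂ))) (𝓝[≠] 0) (𝓝 1) := by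
    have : Continuous (fun u : ℝ => Complex.exp (Complex.I * (u : ℂ))) := by fun_prop
    have h2 := this.tendsto 0
    simp only [Complex.ofReal_zero, mul_zero, Complex.exp_zero] at h2
    exact h2.mono_left nhdsWithin_le_nhds
  have zl : ∀ u, zu z ℓ u ℓ = Complex.exp (Complex.I * (u : ℂ)) := fun u => by simp [zu]
  have zj : ∀ u j, j ≠ ℓ → zu z ℓ u j = z j := fun u j hj => by simp [zu, hj]
  have hZ : ∀ j, Tendsto (fun u => zu z ℓ u j) (𝓝[≠] 0) (𝓝 (z j)) := by
    intro j
    by_cases hj : j = ℓ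
    · subst hj
      simp only [zl, hℓ]
      exact hZ0
    · simp only [zj _ j hj]
      exact tendsto_const_nhds
  have L1 : Tendsto (fun u => ∑ B, transferV N c A B * psiB C m (zu z ℓ u) B) (𝓝[≠] 0)
      (𝓝 (∑ B, transferV N c A B * psiB C m z B)) :=
    tendsto_finsetSum _ (fun B _ => (psiB_tendsto C _ _ _ hZ B).const_mul _)
  have key : ∀ᶠ u : ℝ in 𝓝[≠] 0, ∑ B, transferV N c A B * psiB C m (zu z ℓ u) B =
      ((2 - C) * ∏ j ∈ Finset.univ.erase ℓ, MM C (z j)) * psiB C m (zu z ℓ u) A +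
      ∑ σ : Equiv.Perm (Fin (m+1)), (if σ 0 = ℓ then
        ((LL C (Complex.exp (Complex.I * (u : ℂ))) - 1) * (1 - R u)) * AA C (zu z ℓ u) σ
        else (LL C (z (σ 0)) - 1) *
          (AA C (zu z ℓ u) σ - AA C (zu z ℓ u) (σ * finRotate (m+1)) * z (σ 0) ^ N)) *
        Tc (ap C N (zu z ℓ u) (X2 (xsA m A h)) σ) (ee (zu z ℓ u) (X2 (xsA m A h)) σ) m 1 := by
    filter_upwards [hne, hR] with u hu hRu
    rw [offshell' c A h (zu z ℓ u) (fun j => by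
      by_cases hj : j = ℓ
      · subst hj; rw [zl]; exact hu
      · rw [zj u j hj]; exact hz j hj)]
    congr 1
    · congr 1
      rw [← Finset.mul_prod_erase Finset.univ _ (Finset.mem_univ ℓ),
        ← Finset.mul_prod_erase Finset.univ (fun j => MM _ (zu z ℓ u j)) (Finset.mem_univ ℓ), zl]
      have a1 : ∏ j ∈ Finset.univ.erase ℓ, LL ((c:ℂ)^2) (zu z ℓ u j) =
          ∏ j ∈ Finset.univ.erase ℓ, LL ((c:ℂ)^2) (z j) :=
        Finset.prod_congr rfl (fun j hj => by rw [zj u j (Finset.ne_of_mem_erase hj)])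
      have a2 : ∏ j ∈ Finset.univ.erase ℓ, MM ((c:ℂ)^2) (zu z ℓ u j) =
          ∏ j ∈ Finset.univ.erase ℓ, MM ((c:ℂ)^2) (z j) :=
        Finset.prod_congr rfl (fun j hj => by rw [zj u j (Finset.ne_of_mem_erase hj)])
      rw [a1, a2, ← hC, hprod, ← add_mul]
      congr 1
      have h1 : (1 - Complex.exp (Complex.I * (u : ℂ))) ≠ 0 := sub_ne_zero.mpr hu.symm
      unfold LL MM
      field_simp
      ring
    · refine Finset.sum_congr rfl (fun σ _ => ?_)
      congr 1
      split_ifs with hσ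
      · rw [hRu σ hσ, hσ, zl]
        ring
      · rw [zj u _ hσ]
  have L2 : Tendsto (fun u => ((2 - C) * ∏ j ∈ Finset.univ.erase ℓ, MM C (z j)) *
      psiB C m (zu z ℓ u) A +
      ∑ σ : Equiv.Perm (Fin (m+1)), (if σ 0 = ℓ then
        ((LL C (Complex.exp (Complex.I * (u : ℂ))) - 1) * (1 - R u)) * AA C (zu z ℓ u) σ
        else (LL C (z (σ 0)) - 1) *
          (AA C (zu z ℓ u) σ - AA C (zu z ℓ u) (σ * finRotate (m+1)) * z (σ 0) ^ N)) *
        Tc (ap C N (zu z ℓ u) (X2 (xsA m A h)) σ) (ee (zu z ℓ u) (X2 (xsA m A h)) σ) m 1)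
      (𝓝[≠] 0) (𝓝 (((2 - C) * ∏ j ∈ Finset.univ.erase ℓ, MM C (z j)) * psiB C m z A +
      ∑ σ : Equiv.Perm (Fin (m+1)), (if σ 0 = ℓ then D * AA C z σ
        else (LL C (z (σ 0)) - 1) *
          (AA C z σ - AA C z (σ * finRotate (m+1)) * z (σ 0) ^ N)) *
        Tc (ap C N z (X2 (xsA m A h)) σ) (ee z (X2 (xsA m A h)) σ) m 1)) := by
    refine ((psiB_tendsto C _ _ _ hZ A).const_mul _).add (tendsto_finsetSum _ (fun σ _ => ?_))
    refine Tendsto.mul ?_ (TT_tendsto C _ _ _ hZ _ σ m 1)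
    split_ifs with hσ
    · exact hlim.mul (AA_tendsto C _ _ _ hZ σ)
    · exact Tendsto.const_mul _ ((AA_tendsto C _ _ _ hZ σ).sub
        ((AA_tendsto C _ _ _ hZ _).mul_const _))
  have E := tendsto_nhds_unique (L1.congr' key) L2
  rw [E]
  have X := Xi_final' C A h z ℓ hℓ hz
  have e : ∑ σ : Equiv.Perm (Fin (m+1)), (if σ 0 = ℓ then D * AA C z σ
        else (LL C (z (σ 0)) - 1) *
          (AA C z σ - AA C z (σ * finRotate (m+1)) * z (σ 0) ^ N)) *
        Tc (ap C N z (X2 (xsA m A h)) σ) (ee z (X2 (xsA m A h)) σ) m 1 =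
      D * ∑ σ : Equiv.Perm (Fin (m+1)), AA C z σ * ((if σ 0 = ℓ then 1 else 0) *
      Tc (ap C N z (X2 (xsA m A h)) σ) (ee z (X2 (xsA m A h)) σ) m 1) := by
    rw [Finset.mul_sum]
    refine Finset.sum_congr rfl (fun σ _ => ?_)
    split_ifs with hσ
    · ring
    · rw [hBE σ hσ]; ring
  rw [e, X]
  ring

lemma exp_S (c Δ : ℝ) (hΔ : Δ = (2 - c ^ 2) / 2) (a b : ℝ) :
    Complex.exp (Complex.I * (a : ℂ)) * Sfun Δ a b =
      ss ((c:ℂ)^2) (Complex.exp (Complex.I * (a : ℂ))) (Complex.exp (Complex.I * (b : ℂ))) := by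
  have h1 : Complex.exp (Complex.I * (a : ℂ)) * Complex.exp (-(Complex.I * (a : ℂ))) = 1 := by
    rw [← Complex.exp_add, add_neg_cancel, Complex.exp_zero]
  unfold Sfun ss
  rw [mul_sub, mul_add, h1, hΔ]
  push_cast
  ring

lemma Acoef_eq (c Δ : ℝ) (hΔ : Δ = (2 - c ^ 2) / 2) {n : ℕ} (p : Fin n → ℝ)
    (σ : Equiv.Perm (Fin n)) : Acoef Δ p σ = AA ((c:ℂ)^2) (zOf p) σ := by
  unfold Acoef AA
  congr 1
  refine Finset.prod_congr rfl (fun kl _ => ?_)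
  rw [exp_S c Δ hΔ]
  rfl

lemma psiVec_eq (c Δ : ℝ) (hΔ : Δ = (2 - c ^ 2) / 2) {N m : ℕ} (p : Fin (m+1) → ℝ)
    (A : Finset (Fin N)) : psiVec N (m+1) Δ p A = psiB ((c:ℂ)^2) m (zOf p) A := by
  unfold psiVec psiB
  split_ifs with h
  · unfold psi
    refine Finset.sum_congr rfl (fun σ _ => ?_)
    rw [Acoef_eq c Δ hΔ]
    congr 1
    rw [← Fin.prod_univ_eq_prod_range (fun i => zOf p (σ (idx m i)) ^ xsA m A h i)]
    refine Finset.prod_congr rfl (fun k _ => ?_)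
    rw [idx_fin, xsA, dif_pos k.2, zOf, ← Complex.exp_nat_mul, mul_comm]
    rfl
  · rfl

lemma theta_ss (c Δ : ℝ) (hΔ : Δ = (2 - c ^ 2) / 2) (Θ : ℝ → ℝ → ℝ)
    (hΘ : ∀ a ∈ Ddom Δ, ∀ b ∈ Ddom Δ,
      Complex.exp (-(Complex.I * (Θ a b : ℂ))) =
        Complex.exp (Complex.I * ((a : ℂ) - (b : ℂ))) * Sfun Δ a b / Sfun Δ b a)
    (a b : ℝ) (ha : a ∈ Ddom Δ) (hb : b ∈ Ddom Δ) :
    ss ((c:ℂ)^2) (Complex.exp (Complex.I * (a : ℂ))) (Complex.exp (Complex.I * (b : ℂ))) ≠ 0 ∧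
    Complex.exp (Complex.I * (Θ a b : ℂ)) =
      ss ((c:ℂ)^2) (Complex.exp (Complex.I * (b : ℂ))) (Complex.exp (Complex.I * (a : ℂ))) /
      ss ((c:ℂ)^2) (Complex.exp (Complex.I * (a : ℂ))) (Complex.exp (Complex.I * (b : ℂ))) := by
  have h := hΘ a ha b hb
  have hne := Complex.exp_ne_zero (-(Complex.I * (Θ a b : ℂ)))
  rw [h] at hne
  have hS2 : Sfun Δ b a ≠ 0 := fun h0 => hne (by rw [h0, div_zero])
  have hS1 : Sfun Δ a b ≠ 0 := fun h0 => hne (by rw [h0]; simp)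
  have ea := Complex.exp_ne_zero (Complex.I * (a : ℂ))
  have eb := Complex.exp_ne_zero (Complex.I * (b : ℂ))
  rw [← exp_S c Δ hΔ a b, ← exp_S c Δ hΔ b a]
  refine ⟨mul_ne_zero ea hS1, ?_⟩
  rw [Complex.exp_neg, mul_sub, Complex.exp_sub] at h
  rw [← inv_inv (Complex.exp (Complex.I * (Θ a b : ℂ))), h]
  field_simp

lemma prod_succ_erase {m : ℕ} (f : Fin (m+1) → ℂ) (σ : Equiv.Perm (Fin (m+1))) :
    ∏ k : Fin m, f (σ k.succ) = ∏ j ∈ Finset.univ.erase (σ 0), f j := by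
  symm
  apply Finset.prod_bij' (fun j hj => (σ.symm j).pred (fun h0 => by
      apply Finset.ne_of_mem_erase hj; rw [← h0]; simp)) (fun k _ => σ k.succ)
  · intro j hj; simp
  · intro k _; simp [Fin.succ_ne_zero]
  · intro j hj; simp
  · intro k _; simp
  · intro j hj; simp

lemma rot_theta (c Δ : ℝ) (hΔ : Δ = (2 - c ^ 2) / 2) (Θ : ℝ → ℝ → ℝ)
    (hΘ : ∀ a ∈ Ddom Δ, ∀ b ∈ Ddom Δ,
      Complex.exp (-(Complex.I * (Θ a b : ℂ))) =
        Complex.exp (Complex.I * ((a : ℂ) - (b : ℂ))) * Sfun Δ a b / Sfun Δ b a)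
    {m : ℕ} (p : Fin (m+1) → ℝ) (hpD : ∀ j, p j ∈ Ddom Δ) (σ : Equiv.Perm (Fin (m+1))) :
    AA ((c:ℂ)^2) (zOf p) (σ * finRotate (m+1)) = AA ((c:ℂ)^2) (zOf p) σ * ((-1) ^ m *
      ∏ j ∈ Finset.univ.erase (σ 0), Complex.exp (Complex.I * (Θ (p (σ 0)) (p j) : ℂ))) := by
  have h := AA_rot ((c:ℂ)^2) (zOf p) σ
  have hne : ∏ k : Fin m, ss ((c:ℂ)^2) (zOf p (σ 0)) (zOf p (σ k.succ)) ≠ 0 :=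
    Finset.prod_ne_zero_iff.mpr (fun k _ => (theta_ss c Δ hΔ Θ hΘ _ _ (hpD _) (hpD _)).1)
  rw [← prod_succ_erase (fun j => Complex.exp (Complex.I * (Θ (p (σ 0)) (p j) : ℂ))) σ,
    Finset.prod_congr rfl (fun k _ => (theta_ss c Δ hΔ Θ hΘ _ _ (hpD (σ 0)) (hpD (σ (Fin.succ k)))).2),
    Finset.prod_div_distrib]
  rw [← eq_div_iff hne] at h
  rw [h]
  simp only [zOf]
  ring

lemma zu_zOf {m : ℕ} (p : Fin (m+1) → ℝ) (ℓ : Fin (m+1)) (u : ℝ) :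
    zu (zOf p) ℓ u = zOf (Function.update p ℓ u) := by
  funext j
  by_cases hj : j = ℓ
  · subst hj; simp [zu, zOf]
  · simp [zu, zOf, hj]

lemma exp_ne_one (Δ u : ℝ) (hu : u ∈ Ddom Δ) (h0 : u ≠ 0) :
    Complex.exp (Complex.I * (u : ℂ)) ≠ 1 := by
  have hmu : 0 ≤ muD Δ := by
    unfold muD; split_ifs
    · exact Real.arccos_nonneg _
    · exact le_rfl
  obtain ⟨h1, h2⟩ := hu
  intro he
  have hs : Real.cos u = 1 := by
    have := congrArg Complex.re he
    rw [mul_comm, Complex.exp_ofReal_mul_I_re] at this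
    simpa using this
  exact h0 ((Real.cos_eq_one_iff_of_lt_of_lt (by linarith [Real.pi_pos])
    (by linarith [Real.pi_pos])).mp hs)

lemma theta_deriv (Δ : ℝ) (Θ : ℝ → ℝ → ℝ)
    (hΘdiff : ContDiffOn ℝ 1 (fun q : ℝ × ℝ => Θ q.1 q.2) (Ddom Δ ×ˢ Ddom Δ))
    (a b : ℝ) (ha : a ∈ Ddom Δ) (hb : b ∈ Ddom Δ) :
    HasDerivAt (fun t => Θ t b) (deriv (fun t => Θ t b) a) a := by
  have ho : IsOpen (Ddom Δ ×ˢ Ddom Δ) := isOpen_Ioo.prod isOpen_Ioo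
  have h1 : DifferentiableAt ℝ (fun q : ℝ × ℝ => Θ q.1 q.2) (a, b) :=
    (hΘdiff.contDiffAt (ho.mem_nhds ⟨ha, hb⟩)).differentiableAt (by norm_num)
  have h2 : DifferentiableAt ℝ (fun t : ℝ => (t, b)) a := by fun_prop
  have h3 : DifferentiableAt ℝ (fun t => Θ t b) a :=
    DifferentiableAt.comp (f := fun t : ℝ => (t, b)) a h1 h2
  exact h3.hasDerivAt

lemma lim_lemma (C : ℂ) (R : ℝ → ℂ) (R' : ℂ) (h0 : R 0 = 1)
    (hR : HasDerivAt R (Complex.I * R') 0)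
    (hne : ∀ᶠ u : ℝ in 𝓝[≠] 0, Complex.exp (Complex.I * (u : ℂ)) ≠ 1) :
    Tendsto (fun u : ℝ => (LL C (Complex.exp (Complex.I * (u : ℂ))) - 1) * (1 - R u)) (𝓝[≠] 0)
      (𝓝 (C * R')) := by
  have hE : HasDerivAt (fun u : ℝ => Complex.exp (Complex.I * (u : ℂ))) Complex.I 0 := by
    have h1 : HasDerivAt (fun u : ℝ => Complex.I * (u : ℂ)) (Complex.I * 1) 0 :=
      (Complex.ofRealCLM.hasDerivAt (x := 0)).const_mul Complex.I
    have h2 := h1.cexp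
    simpa using h2
  have s1 := hasDerivAt_iff_tendsto_slope.mp hR
  have s2 := hasDerivAt_iff_tendsto_slope.mp hE
  have e0 : Tendsto (fun u : ℝ => Complex.exp (Complex.I * (u : ℂ))) (𝓝[≠] 0) (𝓝 1) := by
    have := hE.continuousAt.tendsto
    simp only [Complex.ofReal_zero, mul_zero, Complex.exp_zero] at this
    exact this.mono_left nhdsWithin_le_nhds
  have t := (e0.const_mul C).mul (s1.div s2 Complex.I_ne_zero)
  have hval : C * 1 * (Complex.I * R' / Complex.I) = C * R' := by
    field_simp [Complex.I_ne_zero]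
  rw [hval] at t
  refine t.congr' ?_
  filter_upwards [hne, self_mem_nhdsWithin] with u hu hu0
  have hu0' : (u : ℂ) ≠ 0 := by exact_mod_cast hu0
  have h1 : (1 - Complex.exp (Complex.I * (u : ℂ))) ≠ 0 := sub_ne_zero.mpr hu.symm
  have h2 : (Complex.exp (Complex.I * (u : ℂ)) - 1) ≠ 0 := sub_ne_zero.mpr hu
  simp only [slope, vsub_eq_sub, sub_zero, h0, Complex.ofReal_zero, mul_zero, Complex.exp_zero,
    Pi.div_apply, Complex.real_smul, Complex.ofReal_inv]
  rw [mul_div_mul_left _ _ (inv_ne_zero hu0')]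
  unfold LL
  rw [add_sub_cancel_left, mul_div_assoc', div_mul_eq_mul_div, div_eq_div_iff h2 h1]
  ring

lemma main_succ
    (N m : ℕ) (c : ℝ) (Δ : ℝ) (hΔ : Δ = (2 - c ^ 2) / 2)
    (Θ : ℝ → ℝ → ℝ)
    (hΘ : ∀ a ∈ Ddom Δ, ∀ b ∈ Ddom Δ,
      Complex.exp (-(Complex.I * (Θ a b : ℂ))) =
        Complex.exp (Complex.I * ((a : ℂ) - (b : ℂ))) * Sfun Δ a b / Sfun Δ b a)
    (hΘdiff : ContDiffOn ℝ 1 (fun q : ℝ × ℝ => Θ q.1 q.2) (Ddom Δ ×ˢ Ddom Δ))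
    (p : Fin (m+1) → ℝ) (hpD : ∀ j, p j ∈ Ddom Δ)
    (hdistinct : Function.Injective p)
    (hBE : ∀ j, Complex.exp (Complex.I * (N : ℂ) * (p j : ℂ)) =
      (-1 : ℂ) ^ m *
        Complex.exp (-(Complex.I * ((∑ k, Θ (p j) (p k) : ℝ) : ℂ))))
    (ℓ : Fin (m+1)) (hℓ : p ℓ = 0) :
    (transferV N c).mulVec (psiVec N (m+1) Δ p) =
      ((2 + (c : ℂ) ^ 2 * ((N : ℂ) - 1) +
          (c : ℂ) ^ 2 *
            ((∑ j ∈ Finset.univ.erase ℓ, deriv (fun t => Θ t (p j)) 0 : ℝ) : ℂ)) *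
        ∏ j ∈ Finset.univ.erase ℓ, Mfun c (zOf p j)) • psiVec N (m+1) Δ p := by
  have h0D : (0:ℝ) ∈ Ddom Δ := hℓ ▸ hpD ℓ
  have hpsi : psiVec N (m+1) Δ p = psiB ((c:ℂ)^2) m (zOf p) :=
    funext (psiVec_eq c Δ hΔ p)
  have hMf : ∀ z, Mfun c z = MM ((c:ℂ)^2) z := fun z => rfl
  have hzl : zOf p ℓ = 1 := by simp [zOf, hℓ]
  have hzj : ∀ j, j ≠ ℓ → zOf p j ≠ 1 := fun j hj =>
    exp_ne_one Δ _ (hpD j) (fun h => hj (hdistinct (h.trans hℓ.symm)))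
  -- Bethe equation with the diagonal term removed
  have hBE' : ∀ j, zOf p j ^ N * ((-1) ^ m *
      ∏ k ∈ Finset.univ.erase j, Complex.exp (Complex.I * (Θ (p j) (p k) : ℂ))) = 1 := by
    intro j
    have hd : Complex.exp (Complex.I * (Θ (p j) (p j) : ℂ)) = 1 := by
      have := theta_ss c Δ hΔ Θ hΘ _ _ (hpD j) (hpD j)
      rw [this.2, div_self this.1]
    have e1 : zOf p j ^ N = Complex.exp (Complex.I * (N : ℂ) * (p j : ℂ)) := by
      rw [zOf, ← Complex.exp_nat_mul]; congr 1; ring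
    have e2 : ∏ k ∈ Finset.univ.erase j, Complex.exp (Complex.I * (Θ (p j) (p k) : ℂ)) =
        Complex.exp (Complex.I * ((∑ k, Θ (p j) (p k) : ℝ) : ℂ)) := by
      rw [Complex.ofReal_sum, Finset.mul_sum, Complex.exp_sum,
        ← Finset.mul_prod_erase Finset.univ _ (Finset.mem_univ j), hd, one_mul]
    rw [e1, e2, hBE j, Complex.exp_neg]
    have := Complex.exp_ne_zero (Complex.I * ((∑ k, Θ (p j) (p k) : ℝ) : ℂ))
    field_simp
    rw [← pow_mul, mul_comm, pow_mul]; norm_num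
  set R : ℝ → ℂ := fun u => Complex.exp (Complex.I * (N : ℂ) * (u : ℂ)) * ((-1) ^ m *
      ∏ k ∈ Finset.univ.erase ℓ, Complex.exp (Complex.I * (Θ u (p k) : ℂ))) with hRdef
  have hR0 : R 0 = 1 := by
    have := hBE' ℓ
    rw [hzl, one_pow, one_mul, hℓ] at this
    simp only [hRdef, Complex.ofReal_zero, mul_zero, Complex.exp_zero, one_mul]
    exact this
  have hev : ∀ᶠ u : ℝ in 𝓝[≠] 0, u ∈ Ddom Δ :=
    mem_nhdsWithin_of_mem_nhds (isOpen_Ioo.mem_nhds h0D)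
  have hne : ∀ᶠ u : ℝ in 𝓝[≠] 0, Complex.exp (Complex.I * (u : ℂ)) ≠ 1 := by
    filter_upwards [hev, self_mem_nhdsWithin] with u hu hu0
    exact exp_ne_one Δ u hu hu0
  have hRd : HasDerivAt R (Complex.I * ((N : ℂ) +
      ((∑ j ∈ Finset.univ.erase ℓ, deriv (fun t => Θ t (p j)) 0 : ℝ) : ℂ))) 0 := by
    have hR2 : R = fun u : ℝ => (-1) ^ m * Complex.exp (Complex.I *
        ((N * u + ∑ k ∈ Finset.univ.erase ℓ, Θ u (p k) : ℝ) : ℂ)) := by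
      funext u
      simp only [hRdef]
      rw [← Complex.exp_sum, mul_left_comm, ← Complex.exp_add, ← Finset.mul_sum]
      push_cast
      congr 2
      ring
    have hr : HasDerivAt (fun u : ℝ => N * u + ∑ k ∈ Finset.univ.erase ℓ, Θ u (p k))
        ((N : ℝ) * 1 + ∑ j ∈ Finset.univ.erase ℓ, deriv (fun t => Θ t (p j)) 0) 0 := by
      refine ((hasDerivAt_id (0:ℝ)).const_mul (N:ℝ)).add ?_
      exact HasDerivAt.fun_sum (fun j _ => theta_deriv Δ Θ hΘdiff 0 (p j) h0D (hpD j))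
    have h1 := ((hr.ofReal_comp.const_mul Complex.I).cexp).const_mul ((-1 : ℂ) ^ m)
    rw [hR2]
    refine h1.congr_deriv ?_
    have h3 : (-1 : ℂ) ^ m * Complex.exp (Complex.I *
        ((N * 0 + ∑ k ∈ Finset.univ.erase ℓ, Θ 0 (p k) : ℝ) : ℂ)) = 1 := by
      have := hR0
      rw [hR2] at this
      exact this
    rw [← mul_assoc, h3]
    push_cast
    ring
  have hprod : ∏ j ∈ Finset.univ.erase ℓ, LL ((c:ℂ)^2) (zOf p j) =
      ∏ j ∈ Finset.univ.erase ℓ, MM ((c:ℂ)^2) (zOf p j) := by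
    have e : ∀ j ∈ Finset.univ.erase ℓ, LL ((c:ℂ)^2) (zOf p j) = MM ((c:ℂ)^2) (zOf p j) *
        (-1 * Complex.exp (Complex.I * (Θ 0 (p j) : ℂ))) := by
      intro j hj
      have hj1 := hzj j (Finset.ne_of_mem_erase hj)
      have t := theta_ss c Δ hΔ Θ hΘ 0 (p j) h0D (hpD j)
      simp only [Complex.ofReal_zero, mul_zero, Complex.exp_zero] at t
      rw [t.2, LL_eq _ _ hj1, MM_eq _ _ hj1]
      have t1 := t.1
      change ss ((c:ℂ)^2) 1 (zOf p j) ≠ 0 at t1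
      change _ = -ss ((c:ℂ)^2) 1 (zOf p j) / (1 - zOf p j) *
        (-1 * (ss ((c:ℂ)^2) (zOf p j) 1 / ss ((c:ℂ)^2) 1 (zOf p j)))
      have h1 : (1 - zOf p j) ≠ 0 := sub_ne_zero.mpr hj1.symm
      field_simp
    rw [Finset.prod_congr rfl e, Finset.prod_mul_distrib, Finset.prod_mul_distrib,
      Finset.prod_const, Finset.card_erase_of_mem (Finset.mem_univ _), Finset.card_univ,
      Fintype.card_fin, Nat.add_sub_cancel]
    have := hBE' ℓ
    rw [hzl, one_pow, one_mul, hℓ] at this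
    rw [this, mul_one]
  have hB2 : ∀ σ : Equiv.Perm (Fin (m+1)), σ 0 ≠ ℓ →
      AA ((c:ℂ)^2) (zOf p) (σ * finRotate (m+1)) * zOf p (σ 0) ^ N = AA ((c:ℂ)^2) (zOf p) σ := by
    intro σ _
    rw [rot_theta c Δ hΔ Θ hΘ p hpD σ, mul_assoc, mul_comm (_ * _) (_ ^ N), hBE', mul_one]
  have hR : ∀ᶠ u : ℝ in 𝓝[≠] 0, ∀ σ : Equiv.Perm (Fin (m+1)), σ 0 = ℓ →
      AA ((c:ℂ)^2) (zu (zOf p) ℓ u) (σ * finRotate (m+1)) * zu (zOf p) ℓ u (σ 0) ^ N =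
        AA ((c:ℂ)^2) (zu (zOf p) ℓ u) σ * R u := by
    filter_upwards [hev] with u hu σ hσ
    rw [zu_zOf, rot_theta c Δ hΔ Θ hΘ (Function.update p ℓ u) (fun j => by
      by_cases hj : j = ℓ
      · subst hj; simpa using hu
      · simpa [hj] using hpD j) σ, mul_assoc, hσ]
    congr 1
    have e1 : zOf (Function.update p ℓ u) ℓ ^ N = Complex.exp (Complex.I * (N : ℂ) * (u : ℂ)) := by
      rw [zOf, ← Complex.exp_nat_mul, Function.update_self]; congr 1; ring
    have e2 : ∏ j ∈ Finset.univ.erase ℓ, Complex.exp (Complex.I *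
        (Θ (Function.update p ℓ u ℓ) (Function.update p ℓ u j) : ℂ)) =
        ∏ k ∈ Finset.univ.erase ℓ, Complex.exp (Complex.I * (Θ u (p k) : ℂ)) := by
      refine Finset.prod_congr rfl (fun j hj => ?_)
      rw [Function.update_self, Function.update_of_ne (Finset.ne_of_mem_erase hj)]
    rw [e1, e2, mul_comm]
  have hlim := lim_lemma ((c:ℂ)^2) R _ hR0 hRd hne
  rw [hpsi]
  funext A
  simp only [Matrix.mulVec, dotProduct, Pi.smul_apply, smul_eq_mul, hMf]
  by_cases hA : A.card = m + 1
  · rw [limit_thm c A hA (zOf p) ℓ hzl hzj _ R hprod hB2 hne hR hlim]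
    congr 2
    ring
  · have : psiB ((c:ℂ)^2) m (zOf p) A = 0 := by rw [psiB, dif_neg hA]
    rw [this, mul_zero]
    refine Finset.sum_eq_zero (fun B _ => ?_)
    by_cases hB : B.card = m + 1
    · have hAB : A ≠ B := fun e => hA (e ▸ hB)
      have hI : ¬ Interlaced A B := fun hI => hA (hI.1.trans hB)
      simp [transferV, hAB, hI]
    · rw [psiB, dif_neg hB, mul_zero]

end BA

/-- **Bethe ansatz for the six-vertex transfer matrix, singular case** (one entry zero). -/
theorem bethe_ansatz_singular
    (N n : ℕ) (hN : 0 < N) (hn : 2 * n ≤ N)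
    (c : ℝ) (hc : 0 < c) (Δ : ℝ) (hΔ : Δ = (2 - c ^ 2) / 2)
    (Θ : ℝ → ℝ → ℝ)
    (hΘcont : ContinuousOn (fun q : ℝ × ℝ => Θ q.1 q.2) (Ddom Δ ×ˢ Ddom Δ))
    (hΘzero : Θ 0 0 = 0)
    (hΘ : ∀ a ∈ Ddom Δ, ∀ b ∈ Ddom Δ,
      Complex.exp (-(Complex.I * (Θ a b : ℂ))) =
        Complex.exp (Complex.I * ((a : ℂ) - (b : ℂ))) * Sfun Δ a b / Sfun Δ b a)
    (hΘdiff : ContDiffOn ℝ 1 (fun q : ℝ × ℝ => Θ q.1 q.2) (Ddom Δ ×ˢ Ddom Δ))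
    (p : Fin n → ℝ) (hpD : ∀ j, p j ∈ Ddom Δ)
    (hdistinct : Function.Injective p)
    (hBE : ∀ j, Complex.exp (Complex.I * (N : ℂ) * (p j : ℂ)) =
      (-1 : ℂ) ^ (n - 1) *
        Complex.exp (-(Complex.I * ((∑ k, Θ (p j) (p k) : ℝ) : ℂ))))
    (ℓ : Fin n) (hℓ : p ℓ = 0) :
    (transferV N c).mulVec (psiVec N n Δ p) =
      ((2 + (c : ℂ) ^ 2 * ((N : ℂ) - 1) +
          (c : ℂ) ^ 2 *
            ((∑ j ∈ Finset.univ.erase ℓ, deriv (fun t => Θ t (p j)) 0 : ℝ) : ℂ)) *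
        ∏ j ∈ Finset.univ.erase ℓ, Mfun c (zOf p j)) • psiVec N n Δ p := by
  obtain ⟨m, rfl⟩ : ∃ m, n = m + 1 := ⟨n - 1, by have := ℓ.2; omega⟩
  exact BA.main_succ N m c Δ hΔ Θ hΘ hΘdiff p hpD hdistinct hBE ℓ hℓ
end
end
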